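/- arXiv:1703.04076 — 2 statements merged into one kernel-verified Lean document; each statement's English description precedes it below -/
import Mathlib

section
/- The following statements are equivalent: (1) every F-algebra endomorphism of A is an automorphism; (2) every solvable element of A lies in Δ1 (i.e., is strictly nilpotent); (3) no element of Δ2 is solvable. (Theorem 3.8) -/
open scoped BigOperators

/-- Defining relation of the Weyl algebra: `p * q = q * p + 1`. -/
inductive WeylRel (F : Type*) [CommRing F] :
    FreeAlgebra F (Fin 2) → FreeAlgebra F (Fin 2) → Prop
  | comm : WeylRel F (FreeAlgebra.ι F 0 * FreeAlgebra.ι F 1)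
      (FreeAlgebra.ι F 1 * FreeAlgebra.ι F 0 + 1)

/-- The Weyl algebra over `F`. -/
abbrev WeylAlgebra (F : Type*) [CommRing F] := RingQuot (WeylRel F)

variable (F : Type*) [Field F] [CharZero F]

/-- The generator `p` of the Weyl algebra. -/
noncomputable def Wp : WeylAlgebra F :=
  RingQuot.mkAlgHom F (WeylRel F) (FreeAlgebra.ι F 0)

/-- The generator `q` of the Weyl algebra. -/
noncomputable def Wq : WeylAlgebra F :=
  RingQuot.mkAlgHom F (WeylRel F) (FreeAlgebra.ι F 1)

/-- `x` is solvable if `[x, y] = 1` for some `y`. -/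
def Solvable (x : WeylAlgebra F) : Prop := ∃ y : WeylAlgebra F, x * y - y * x = 1

/-- The centralizer `C(x)`. -/
def Cset (x : WeylAlgebra F) : Set (WeylAlgebra F) := {y | x * y - y * x = 0}

/-- `N(x) = {y | (ad x)^n y = 0 for some n ≥ 1}`. -/
def Nset (x : WeylAlgebra F) : Set (WeylAlgebra F) :=
  {y | ∃ n : ℕ, 1 ≤ n ∧ (fun z => x * z - z * x)^[n] y = 0}

/-- `D(x) = {y | [x,y] = λ y for some scalar λ}`. -/
def Dset (x : WeylAlgebra F) : Set (WeylAlgebra F) :=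
  {y | ∃ c : F, x * y - y * x = c • y}

def Delta1 : Set (WeylAlgebra F) :=
  {x | x ∉ Set.range (algebraMap F (WeylAlgebra F)) ∧
    Nset F x = Set.univ ∧ Dset F x = Cset F x}

def Delta2 : Set (WeylAlgebra F) :=
  {x | x ∉ Set.range (algebraMap F (WeylAlgebra F)) ∧
    Nset F x ≠ Set.univ ∧ Nset F x ≠ Cset F x ∧ Dset F x = Cset F x}

/-- The graded component `A_s = {a | [pq, a] = s • a}`. -/
def Wgrade (s : ℤ) : Set (WeylAlgebra F) :=
  {a | (Wp F * Wq F) * a - a * (Wp F * Wq F) = s • a}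

/-- The monomial `p^i q^j`. -/
noncomputable def Wmono (i j : ℕ) : WeylAlgebra F := Wp F ^ i * Wq F ^ j

/-- `α` is the coordinate family of `x` in the basis `p^i q^j`. -/
def Represents (α : (ℕ × ℕ) →₀ F) (x : WeylAlgebra F) : Prop :=
  x = α.sum fun ij c => c • Wmono F ij.1 ij.2

/-- `v_{ρ,σ}(x) = max { iρ + jσ | (i,j) ∈ E(x) }`. -/
def vdeg (α : (ℕ × ℕ) →₀ F) (ρ σ : ℕ) : ℕ :=
  α.support.sup fun ij => ij.1 * ρ + ij.2 * σ

/-- `E_{ρ,σ}(x)`. -/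
def Eset (α : (ℕ × ℕ) →₀ F) (ρ σ : ℕ) : Finset (ℕ × ℕ) :=
  α.support.filter fun ij => ij.1 * ρ + ij.2 * σ = vdeg F α ρ σ

/-- The `(ρ,σ)`-polynomial of `x`, an element of `F[X,Y]`. -/
noncomputable def wpoly (α : (ℕ × ℕ) →₀ F) (ρ σ : ℕ) : MvPolynomial (Fin 2) F :=
  ∑ ij ∈ Eset F α ρ σ,
    MvPolynomial.monomial (Finsupp.single 0 ij.1 + Finsupp.single 1 ij.2) (α ij)

/-- The `(ρ,σ)`-term of `x`, an element of the Weyl algebra. -/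
noncomputable def wterm (α : (ℕ × ℕ) →₀ F) (ρ σ : ℕ) : WeylAlgebra F :=
  ∑ ij ∈ Eset F α ρ σ, α ij • Wmono F ij.1 ij.2

open Polynomial

section Commutator

variable {K B : Type*} [Field K] [Ring B] [Algebra K B]

variable (K) in
/-- The inner derivation `a ↦ x * a - a * x` as a linear map. -/
def adMap (x : B) : Module.End K B := LinearMap.mulLeft K x - LinearMap.mulRight K x

@[simp]
theorem adMap_apply (x a : B) : adMap K x a = x * a - a * x := rfl

theorem adMap_mul (x a b : B) : adMap K x (a * b) = adMap K x a * b + a * adMap K x b := by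
  simp only [adMap_apply]; noncomm_ring

theorem adMap_pow_succ (x a : B) (n : ℕ) :
    (adMap K x ^ (n + 1)) a = adMap K x ((adMap K x ^ n) a) := by
  rw [pow_succ', Module.End.mul_apply]

theorem adMap_pow_eq_zero_of_le {x a : B} {m n : ℕ} (h : m ≤ n)
    (ha : (adMap K x ^ m) a = 0) : (adMap K x ^ n) a = 0 := by
  obtain ⟨k, rfl⟩ := Nat.exists_eq_add_of_le' h
  rw [pow_add, Module.End.mul_apply, ha, map_zero]

theorem adMap_pow_mul (x a b : B) (n : ℕ) :
    (adMap K x ^ n) (a * b) = ∑ ij ∈ Finset.HasAntidiagonal.antidiagonal n,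
      n.choose ij.1 • ((adMap K x ^ ij.1) a * (adMap K x ^ ij.2) b) := by
  induction n with
  | zero => simp
  | succ n ih =>
    rw [Finset.sum_antidiagonal_choose_succ_nsmul
      (fun i j => (adMap K x ^ i) a * (adMap K x ^ j) b) n]
    simp only [adMap_pow_succ, ih, map_sum, map_nsmul, adMap_mul, smul_add,
      Finset.sum_add_distrib]
    rw [add_comm]
    congr 1
    refine Finset.sum_congr rfl fun ⟨i, j⟩ hij ↦ ?_
    rw [n.choose_symm_of_eq_add (Finset.HasAntidiagonal.mem_antidiagonal.1 hij).symm]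

theorem adMap_pow_add_mul {x a b : B} {m n : ℕ} (ha : (adMap K x ^ (m + 1)) a = 0)
    (hb : (adMap K x ^ (n + 1)) b = 0) :
    (adMap K x ^ (m + n)) (a * b) =
      (m + n).choose m • ((adMap K x ^ m) a * (adMap K x ^ n) b) := by
  rw [adMap_pow_mul]
  refine Finset.sum_eq_single (m, n) (fun ij hij hne => ?_) (fun h => absurd (by simp) h)
  rw [Finset.HasAntidiagonal.mem_antidiagonal] at hij
  rcases lt_trichotomy ij.1 m with h | h | h
  · rw [adMap_pow_eq_zero_of_le (by omega : n + 1 ≤ ij.2) hb, mul_zero, smul_zero]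
  · exact absurd (Prod.ext h (by simp; omega)) hne
  · rw [adMap_pow_eq_zero_of_le (by omega : m + 1 ≤ ij.1) ha, zero_mul, smul_zero]

theorem adMap_pow_mul_eq_zero {x a b : B} {m n k : ℕ} (ha : (adMap K x ^ m) a = 0)
    (hb : (adMap K x ^ n) b = 0) (hk : m + n ≤ k + 1) : (adMap K x ^ k) (a * b) = 0 := by
  rw [adMap_pow_mul]
  refine Finset.sum_eq_zero fun ij hij => ?_
  rw [Finset.HasAntidiagonal.mem_antidiagonal] at hij
  rcases le_or_gt m ij.1 with h | h
  · rw [adMap_pow_eq_zero_of_le h ha, zero_mul, smul_zero]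
  · rw [adMap_pow_eq_zero_of_le (by omega : n ≤ ij.2) hb, mul_zero, smul_zero]

/-- If `[x, v] = w` commutes with `x`, then `[f(x), v] = f'(x) w`. -/
theorem aeval_mul_sub_mul_aeval {x v w : B} (h : x * v - v * x = w) (hw : Commute x w)
    (f : K[X]) :
    aeval x f * v - v * aeval x f = aeval x (derivative f) * w := by
  have hpow : ∀ n : ℕ, x ^ (n + 1) * v - v * x ^ (n + 1) = (n + 1 : ℕ) * (x ^ n * w) := by
    intro n
    induction n with
    | zero => simpa using h
    | succ n ih =>
      have : x ^ (n + 1 + 1) * v - v * x ^ (n + 1 + 1) =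
          x ^ (n + 1) * (x * v - v * x) + (x ^ (n + 1) * v - v * x ^ (n + 1)) * x := by
        simp only [pow_succ]; noncomm_ring
      rw [this, ih, h, mul_assoc _ _ x, mul_assoc _ w x, ← hw.eq, ← mul_assoc (x ^ n) x w,
        ← pow_succ]
      push_cast
      noncomm_ring
  induction f using Polynomial.induction_on' with
  | add f g hf hg => simp only [map_add, add_mul, mul_add, ← hf, ← hg]; abel
  | monomial n c =>
    rw [derivative_monomial, aeval_monomial, aeval_monomial]
    cases n with
    | zero => simp [Algebra.commutes]
    | succ n =>
      have h1 : algebraMap K B c * x ^ (n + 1) * v - v * (algebraMap K B c * x ^ (n + 1)) =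
          algebraMap K B c * (x ^ (n + 1) * v - v * x ^ (n + 1)) := by
        rw [← mul_assoc v, ← Algebra.commutes c v]; noncomm_ring
      rw [h1, hpow]
      simp only [map_mul, map_natCast, Nat.add_sub_cancel, mul_assoc]

variable (K) in
/-- The map `K[X][Y] → B`, `∑ fⱼ(X) Yʲ ↦ ∑ fⱼ(x) yʲ`. -/
noncomputable def orderedEval (x y : B) (f : K[X][X]) : B :=
  eval₂ (aeval (R := K) x : K[X] →+* B) y f

theorem orderedEval_add (x y : B) (f g : K[X][X]) :
    orderedEval K x y (f + g) = orderedEval K x y f + orderedEval K x y g :=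
  eval₂_add ..

theorem orderedEval_zero (x y : B) : orderedEval K x y 0 = 0 := eval₂_zero ..

theorem orderedEval_monomial (x y : B) (n : ℕ) (f : K[X]) :
    orderedEval K x y (monomial n f) = aeval x f * y ^ n :=
  eval₂_monomial ..

theorem orderedEval_C (x y : B) (f : K[X]) : orderedEval K x y (C f) = aeval x f :=
  eval₂_C ..

theorem orderedEval_smul (x y : B) (c : K) (f : K[X][X]) :
    orderedEval K x y (c • f) = c • orderedEval K x y f := by
  induction f using Polynomial.induction_on' with
  | add f g hf hg => rw [smul_add, orderedEval_add, hf, hg, orderedEval_add, smul_add]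
  | monomial n f =>
    rw [smul_monomial, orderedEval_monomial, orderedEval_monomial, map_smul, smul_mul_assoc]

section Canonical

variable {x y : B} (h : x * y - y * x = 1)

include h

theorem adMap_aeval (f : K[X]) : adMap K y (aeval x f) = - aeval x (derivative f) := by
  have := aeval_mul_sub_mul_aeval h (Commute.one_right x) f
  rw [mul_one] at this
  rw [adMap_apply, ← this, neg_sub]

theorem adMap_aeval_right (f : K[X]) : adMap K x (aeval y f) = aeval y (derivative f) := by
  have := aeval_mul_sub_mul_aeval (K := K) (x := y) (v := x) (w := -1)
    (by rw [← h, neg_sub]) (Commute.neg_one_right y) f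
  rw [adMap_apply, ← neg_sub, this]; simp

theorem adMap_pow_right (n : ℕ) : adMap K x (y ^ n) = n * y ^ (n - 1) := by
  have := adMap_aeval_right (K := K) h (X ^ n)
  simpa [derivative_X_pow, -adMap_apply] using this

theorem adMap_orderedEval (f : K[X][X]) :
    adMap K x (orderedEval K x y f) = orderedEval K x y (derivative f) := by
  induction f using Polynomial.induction_on' with
  | add f g hf hg => simp only [orderedEval_add, map_add, hf, hg]
  | monomial n f =>
    have h0 : adMap K x (aeval x f) = 0 := by
      rw [adMap_apply, sub_eq_zero]
      simpa using congrArg (aeval x) (mul_comm X f)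
    rw [orderedEval_monomial, adMap_mul, h0, zero_mul, zero_add, adMap_pow_right h,
      derivative_monomial, orderedEval_monomial, map_mul, map_natCast, mul_assoc]

theorem adMap_pow_orderedEval (n : ℕ) (f : K[X][X]) :
    (adMap K x ^ n) (orderedEval K x y f) = orderedEval K x y (derivative^[n] f) := by
  induction n with
  | zero => simp
  | succ n ih => rw [adMap_pow_succ, ih, adMap_orderedEval h, Function.iterate_succ_apply']

variable [CharZero K] [Nontrivial B]

theorem aeval_left_ne_zero {f : K[X]} (hf : f ≠ 0) : aeval x f ≠ 0 := by
  induction hn : f.natDegree using Nat.strong_induction_on generalizing f with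
  | _ n ih =>
    intro h0
    rcases Nat.eq_zero_or_pos n with hn0 | hn0
    · rw [hn0] at hn
      obtain ⟨c, rfl⟩ := natDegree_eq_zero.1 hn
      rw [aeval_C, map_eq_zero_iff _ (algebraMap K B).injective] at h0
      exact hf (by rw [h0, C_0])
    · have h1 : derivative f ≠ 0 := fun hd => by
        have := derivative_eq_zero.1 hd
        omega
      refine ih _ (hn ▸ natDegree_derivative_lt (by omega)) h1 rfl ?_
      have := adMap_aeval h f
      rw [h0, map_zero] at this
      exact neg_eq_zero.1 this.symm

theorem aeval_left_injective : Function.Injective (aeval x : K[X] →ₐ[K] B) :=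
  (injective_iff_map_eq_zero _).2 fun _ hf => by_contra fun hne => aeval_left_ne_zero h hne hf

theorem orderedEval_ne_zero {f : K[X][X]} (hf : f ≠ 0) : orderedEval K x y f ≠ 0 := by
  intro h0
  have h1 := adMap_pow_orderedEval h f.natDegree f
  rw [h0, map_zero] at h1
  have h2 : derivative^[f.natDegree] f = C ((f.natDegree.factorial : K[X]) * f.leadingCoeff) := by
    have hd : (derivative^[f.natDegree] f).natDegree = 0 := by
      simpa using natDegree_iterate_derivative f f.natDegree
    rw [eq_C_of_natDegree_eq_zero hd, coeff_iterate_derivative, zero_add,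
      Nat.descFactorial_self, nsmul_eq_mul, leadingCoeff]
  rw [h2, orderedEval_C] at h1
  refine aeval_left_ne_zero h ?_ h1.symm
  exact mul_ne_zero (by exact_mod_cast f.natDegree.factorial_ne_zero) (leadingCoeff_ne_zero.2 hf)

end Canonical

end Commutator

section WeylPair

variable {K B : Type*} [Field K] [Ring B] [Algebra K B]

variable (K) in
/-- A pair of algebra generators of `B` satisfying the Weyl relation. -/
structure IsWeylPair (p q : B) : Prop where
  lie : p * q - q * p = 1
  adjoin : Algebra.adjoin K {p, q} = ⊤

variable (K) in
/-- The span of the monomials `p ^ i * q ^ j` with `i, j ≤ N`. -/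
noncomputable def boxSpan (p q : B) (N : ℕ) : Submodule K B :=
  Submodule.span K ((fun ij : ℕ × ℕ => p ^ ij.1 * q ^ ij.2) ''
    (Finset.range (N + 1) ×ˢ Finset.range (N + 1) : Finset (ℕ × ℕ)))

theorem monomial_mem_boxSpan (p q : B) {i j N : ℕ} (hi : i ≤ N) (hj : j ≤ N) :
    p ^ i * q ^ j ∈ boxSpan K p q N :=
  Submodule.subset_span ⟨(i, j), by simp; omega, rfl⟩

theorem boxSpan_le {p q : B} {N : ℕ} {S : Submodule K B}
    (h : ∀ i ≤ N, ∀ j ≤ N, p ^ i * q ^ j ∈ S) : boxSpan K p q N ≤ S := by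
  refine Submodule.span_le.2 ?_
  rintro _ ⟨⟨i, j⟩, hij, rfl⟩
  simp only [Finset.coe_product, Finset.coe_range, Set.mem_prod, Set.mem_Iio] at hij
  exact h i (by omega) j (by omega)

theorem boxSpan_mono (p q : B) : Monotone (boxSpan K p q) := fun _ _ hMN =>
  boxSpan_le fun _ hi _ hj => monomial_mem_boxSpan p q (hi.trans hMN) (hj.trans hMN)

theorem finrank_boxSpan_le (p q : B) (N : ℕ) :
    Module.finrank K (boxSpan K p q N) ≤ (N + 1) ^ 2 := by
  classical
  rw [boxSpan, ← Finset.coe_image]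
  refine (finrank_span_finset_le_card _).trans (Finset.card_image_le.trans ?_)
  rw [Finset.card_product, Finset.card_range, sq]

instance (p q : B) (N : ℕ) : Module.Finite K (boxSpan K p q N) :=
  Module.Finite.span_of_finite K ((Finset.finite_toSet _).image _)

section Relation

variable {p q : B} (h : p * q - q * p = 1)

theorem mul_right_mem_boxSpan {a : B} {N : ℕ} (ha : a ∈ boxSpan K p q N) :
    a * q ∈ boxSpan K p q (N + 1) := by
  refine (boxSpan_le (S := (boxSpan K p q (N + 1)).comap (LinearMap.mulRight K q))
    fun i hi j hj => ?_) ha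
  rw [Submodule.mem_comap, LinearMap.mulRight_apply, mul_assoc, ← pow_succ]
  exact monomial_mem_boxSpan p q (by omega) (by omega)

include h

theorem mul_left_mem_boxSpan {a : B} {N : ℕ} (ha : a ∈ boxSpan K p q N) :
    a * p ∈ boxSpan K p q (N + 1) := by
  refine (boxSpan_le (S := (boxSpan K p q (N + 1)).comap (LinearMap.mulRight K p))
    fun i hi j hj => ?_) ha
  have h1 := adMap_pow_right (K := K) h j
  rw [adMap_apply] at h1
  have h2 : p ^ i * q ^ j * p = p ^ (i + 1) * q ^ j - (j : K) • (p ^ i * q ^ (j - 1)) := by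
    rw [Algebra.smul_def, map_natCast, ← mul_assoc, Nat.cast_comm, mul_assoc, mul_assoc,
      ← h1, pow_succ]
    noncomm_ring
  rw [Submodule.mem_comap, LinearMap.mulRight_apply, h2]
  exact sub_mem (monomial_mem_boxSpan p q (by omega) (by omega))
    (Submodule.smul_mem _ _ (monomial_mem_boxSpan p q (by omega) (by omega)))

theorem mul_mem_boxSpan {a b : B} {M N : ℕ} (ha : a ∈ boxSpan K p q M)
    (hb : b ∈ boxSpan K p q N) : a * b ∈ boxSpan K p q (M + 2 * N) := by
  refine (boxSpan_le (S := (boxSpan K p q (M + 2 * N)).comap (LinearMap.mulLeft K a))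
    fun i hi j hj => ?_) hb
  have hp : ∀ i : ℕ, a * p ^ i ∈ boxSpan K p q (M + i) := by
    intro i
    induction i with
    | zero => simpa using ha
    | succ i ih => rw [pow_succ, ← mul_assoc]; exact mul_left_mem_boxSpan h ih
  have hq : ∀ j : ℕ, a * p ^ i * q ^ j ∈ boxSpan K p q (M + i + j) := by
    intro j
    induction j with
    | zero => simpa using hp i
    | succ j ih => rw [pow_succ, ← mul_assoc]; exact mul_right_mem_boxSpan ih
  rw [Submodule.mem_comap, LinearMap.mulLeft_apply, ← mul_assoc]
  exact boxSpan_mono p q (by omega) (hq j)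

theorem mul_pow_mem_boxSpan {a b : B} {M N : ℕ} (ha : a ∈ boxSpan K p q M)
    (hb : b ∈ boxSpan K p q N) (n : ℕ) : a * b ^ n ∈ boxSpan K p q (M + 2 * N * n) := by
  induction n with
  | zero => simpa using ha
  | succ n ih =>
    rw [pow_succ, ← mul_assoc]
    exact boxSpan_mono p q (by rw [mul_add]; omega) (mul_mem_boxSpan h ih hb)

end Relation

namespace IsWeylPair

variable {p q : B} (h : IsWeylPair K p q)

include h

theorem symm : IsWeylPair K q (-p) where
  lie := by rw [← h.lie]; noncomm_ring
  adjoin := by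
    rw [← h.adjoin]
    refine le_antisymm (Algebra.adjoin_le ?_) (Algebra.adjoin_le ?_)
    · rintro _ (rfl | rfl)
      · exact Algebra.subset_adjoin (by simp)
      · exact neg_mem (Algebra.subset_adjoin (by simp))
    · rintro _ (rfl | rfl)
      · rw [SetLike.mem_coe, ← neg_mem_iff]
        exact Algebra.subset_adjoin (by simp)
      · exact Algebra.subset_adjoin (by simp)

theorem exists_mem_boxSpan (a : B) : ∃ N, a ∈ boxSpan K p q N := by
  have ha : a ∈ Algebra.adjoin K {p, q} := h.adjoin ▸ trivial
  induction ha using Algebra.adjoin_induction with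
  | mem x hx =>
    refine ⟨1, ?_⟩
    rcases hx with rfl | rfl
    · simpa using monomial_mem_boxSpan (K := K) x q le_rfl zero_le_one
    · simpa using monomial_mem_boxSpan (K := K) p x zero_le_one le_rfl
  | algebraMap r =>
    refine ⟨0, ?_⟩
    rw [Algebra.algebraMap_eq_smul_one]
    exact Submodule.smul_mem _ _ (by
      simpa using monomial_mem_boxSpan (K := K) (N := 0) p q le_rfl le_rfl)
  | add x y _ _ hx hy =>
    obtain ⟨M, hM⟩ := hx
    obtain ⟨N, hN⟩ := hy
    exact ⟨max M N, add_mem (boxSpan_mono p q (le_max_left ..) hM)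
      (boxSpan_mono p q (le_max_right ..) hN)⟩
  | mul x y _ _ hx hy =>
    obtain ⟨M, hM⟩ := hx
    obtain ⟨N, hN⟩ := hy
    exact ⟨_, mul_mem_boxSpan h.lie hM hN⟩

theorem exists_orderedEval (a : B) : ∃ f, orderedEval K p q f = a := by
  obtain ⟨N, hN⟩ := h.exists_mem_boxSpan a
  rw [boxSpan] at hN
  induction hN using Submodule.span_induction with
  | mem x hx =>
    obtain ⟨⟨i, j⟩, -, rfl⟩ := hx
    exact ⟨monomial j (X ^ i), by rw [orderedEval_monomial]; simp⟩
  | zero => exact ⟨0, orderedEval_zero p q⟩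
  | add x y _ _ hx hy =>
    obtain ⟨f, rfl⟩ := hx
    obtain ⟨g, rfl⟩ := hy
    exact ⟨f + g, orderedEval_add p q f g⟩
  | smul c x _ hx =>
    obtain ⟨f, rfl⟩ := hx
    exact ⟨c • f, orderedEval_smul p q c f⟩

theorem exists_adMap_pow_eq_zero (a : B) : ∃ n, (adMap K p ^ n) a = 0 := by
  obtain ⟨f, rfl⟩ := h.exists_orderedEval a
  exact ⟨f.natDegree + 1, by
    rw [adMap_pow_orderedEval h.lie, iterate_derivative_eq_zero (Nat.lt_succ_self _),
      orderedEval_zero]⟩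

theorem exists_aeval_of_commute [CharZero K] [Nontrivial B] {a : B} (ha : adMap K p a = 0) :
    ∃ f : K[X], aeval p f = a := by
  obtain ⟨f, rfl⟩ := h.exists_orderedEval a
  rw [adMap_orderedEval h.lie] at ha
  have hf : derivative f = 0 := by_contra fun hne => orderedEval_ne_zero h.lie hne ha
  rw [eq_C_of_natDegree_eq_zero (derivative_eq_zero.1 hf), orderedEval_C]
  exact ⟨_, rfl⟩

end IsWeylPair

variable (K) in
/-- The degree function of the derivation `ad p`. -/
noncomputable def adDeg (p a : B) : ℕ := sInf {n | (adMap K p ^ (n + 1)) a = 0}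

theorem adMap_pow_adDeg_ne_zero {p a : B} (ha : a ≠ 0) : (adMap K p ^ adDeg K p a) a ≠ 0 := by
  intro h0
  rcases hd : adDeg K p a with _ | d
  · rw [hd, pow_zero] at h0
    exact ha h0
  · rw [hd] at h0
    have : adDeg K p a ≤ d := Nat.sInf_le h0
    omega

theorem adDeg_le {p a : B} {n : ℕ} (h : (adMap K p ^ (n + 1)) a = 0) : adDeg K p a ≤ n :=
  Nat.sInf_le h

theorem adDeg_lt {p a : B} {n : ℕ} (ha : a ≠ 0) (h : (adMap K p ^ n) a = 0) :
    adDeg K p a < n := by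
  by_contra! hn
  exact adMap_pow_adDeg_ne_zero ha (adMap_pow_eq_zero_of_le hn h)

theorem adDeg_algebraMap (p : B) (c : K) : adDeg K p (algebraMap K B c) = 0 :=
  Nat.le_zero.1 (adDeg_le (by simp [Algebra.commutes]))

namespace IsWeylPair

variable {p q : B} (h : IsWeylPair K p q)

include h

theorem adMap_pow_eq_zero {a : B} {n : ℕ} (hn : adDeg K p a < n) : (adMap K p ^ n) a = 0 := by
  obtain ⟨m, hm⟩ := h.exists_adMap_pow_eq_zero a
  have : (adMap K p ^ (adDeg K p a + 1)) a = 0 :=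
    Nat.sInf_mem (s := {n | (adMap K p ^ (n + 1)) a = 0})
      ⟨m, adMap_pow_eq_zero_of_le (Nat.le_succ m) hm⟩
  exact adMap_pow_eq_zero_of_le hn this

theorem adDeg_adMap_le (y a : B) : adDeg K p (adMap K y a) ≤ adDeg K p a + adDeg K p y :=
  adDeg_le <| by
    have ha := h.adMap_pow_eq_zero (Nat.lt_succ_self (adDeg K p a))
    have hy := h.adMap_pow_eq_zero (Nat.lt_succ_self (adDeg K p y))
    rw [adMap_apply, map_sub, adMap_pow_mul_eq_zero hy ha (by omega),
      adMap_pow_mul_eq_zero ha hy (by omega), sub_zero]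

theorem adMap_pow_pow_eq_zero (a : B) (k : ℕ) :
    (adMap K p ^ (k * adDeg K p a + 1)) (a ^ k) = 0 := by
  induction k with
  | zero => simp
  | succ k ih =>
    have ha := h.adMap_pow_eq_zero (Nat.lt_succ_self (adDeg K p a))
    rw [pow_succ a]
    exact adMap_pow_mul_eq_zero ih ha (by rw [add_mul k 1]; omega)

variable [CharZero K] [Nontrivial B]

theorem exists_adMap_pow_adDeg (a : B) :
    ∃ f : K[X], aeval p f = (adMap K p ^ adDeg K p a) a :=
  h.exists_aeval_of_commute (by
    rw [← adMap_pow_succ]; exact h.adMap_pow_eq_zero (Nat.lt_succ_self _))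

theorem mul_ne_zero_and_adDeg {a b : B} (ha : a ≠ 0) (hb : b ≠ 0) :
    a * b ≠ 0 ∧ adDeg K p (a * b) = adDeg K p a + adDeg K p b := by
  obtain ⟨f, hf⟩ := h.exists_adMap_pow_adDeg a
  obtain ⟨g, hg⟩ := h.exists_adMap_pow_adDeg b
  have ha' := h.adMap_pow_eq_zero (Nat.lt_succ_self (adDeg K p a))
  have hb' := h.adMap_pow_eq_zero (Nat.lt_succ_self (adDeg K p b))
  have hf0 : f ≠ 0 := by
    rintro rfl
    exact adMap_pow_adDeg_ne_zero ha (by rw [← hf, map_zero])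
  have hg0 : g ≠ 0 := by
    rintro rfl
    exact adMap_pow_adDeg_ne_zero hb (by rw [← hg, map_zero])
  have key : (adMap K p ^ (adDeg K p a + adDeg K p b)) (a * b) ≠ 0 := by
    rw [adMap_pow_add_mul ha' hb', ← hf, ← hg, ← map_mul, ← map_nsmul]
    refine aeval_left_ne_zero h.lie ?_
    rw [nsmul_eq_mul]
    refine mul_ne_zero ?_ (mul_ne_zero hf0 hg0)
    exact_mod_cast (Nat.choose_pos (Nat.le_add_right ..)).ne'
  have hne : a * b ≠ 0 := fun h0 => key (by rw [h0, map_zero])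
  refine ⟨hne, le_antisymm (adDeg_le ?_) ?_⟩
  · exact adMap_pow_mul_eq_zero ha' hb' (by omega)
  · by_contra! hlt
    exact key (h.adMap_pow_eq_zero hlt)

theorem noZeroDivisors : NoZeroDivisors B where
  eq_zero_or_eq_zero_of_mul_eq_zero {a b} hab := by
    by_contra! hne
    exact (h.mul_ne_zero_and_adDeg hne.1 hne.2).1 hab

theorem adDeg_pow {a : B} (ha : a ≠ 0) (n : ℕ) :
    a ^ n ≠ 0 ∧ adDeg K p (a ^ n) = n * adDeg K p a := by
  induction n with
  | zero => simpa using adDeg_algebraMap p (1 : K)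
  | succ n ih =>
    have := h.mul_ne_zero_and_adDeg ih.1 ha
    rw [pow_succ]
    exact ⟨this.1, by rw [this.2, ih.2, add_mul, one_mul]⟩

/-- The graded algebra of the filtration by `ad p`-degree is commutative. -/
theorem adMap_pow_commutator (a b : B) :
    (adMap K p ^ (adDeg K p a + adDeg K p b)) (a * b - b * a) = 0 := by
  obtain ⟨f, hf⟩ := h.exists_adMap_pow_adDeg a
  obtain ⟨g, hg⟩ := h.exists_adMap_pow_adDeg b
  have ha' := h.adMap_pow_eq_zero (Nat.lt_succ_self (adDeg K p a))
  have hb' := h.adMap_pow_eq_zero (Nat.lt_succ_self (adDeg K p b))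
  rw [map_sub, adMap_pow_add_mul ha' hb', add_comm, adMap_pow_add_mul hb' ha', ← hf, ← hg,
    ← map_mul, ← map_mul, mul_comm g f, Nat.choose_symm_add, sub_self]

end IsWeylPair

end WeylPair

section Centralizer

theorem Polynomial.natDegree_eq_of_derivative_mul_eq {K : Type*} [Field K] [CharZero K]
    {g h : K[X]} (hg : g ≠ 0) (hh : h ≠ 0) (hw : derivative g * h = derivative h * g) :
    g.natDegree = h.natDegree := by
  have hdeg : ∀ f : K[X], (X * derivative f).natDegree ≤ f.natDegree := fun f => by
    rcases Nat.eq_zero_or_pos f.natDegree with h0 | h0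
    · rw [derivative_eq_zero.2 h0]; simp
    · refine natDegree_mul_le.trans ?_
      have := natDegree_derivative_lt h0.ne'
      rw [natDegree_X]; omega
  have hcoeff : ∀ f : K[X], (X * derivative f).coeff f.natDegree =
      f.leadingCoeff * f.natDegree := fun f => by
    rcases hn : f.natDegree with _ | n
    · simp
    · rw [coeff_X_mul, coeff_derivative, leadingCoeff, hn]; push_cast; rfl
  have h1 : (X * derivative g * h).coeff (g.natDegree + h.natDegree) =
      (X * derivative h * g).coeff (h.natDegree + g.natDegree) := by
    rw [mul_assoc, hw, mul_assoc, add_comm]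
  rw [coeff_mul_add_eq_of_natDegree_le (hdeg g) le_rfl,
    coeff_mul_add_eq_of_natDegree_le (hdeg h) le_rfl,
    hcoeff, hcoeff, coeff_natDegree, coeff_natDegree] at h1
  have h2 : (g.natDegree : K) = h.natDegree := by
    have hne := mul_ne_zero (leadingCoeff_ne_zero.2 hg) (leadingCoeff_ne_zero.2 hh)
    exact mul_left_cancel₀ hne (by linear_combination h1)
  exact_mod_cast h2

theorem Polynomial.exists_eq_smul_of_derivative_mul_eq {K : Type*} [Field K] [CharZero K]
    {g h : K[X]} (hh : h ≠ 0) (hw : derivative g * h = derivative h * g) :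
    ∃ c : K, g = c • h := by
  rcases eq_or_ne g 0 with rfl | hg
  · exact ⟨0, by simp⟩
  have hgh := natDegree_eq_of_derivative_mul_eq hg hh hw
  refine ⟨g.leadingCoeff / h.leadingCoeff, ?_⟩
  set c := g.leadingCoeff / h.leadingCoeff with hc
  by_contra hne
  have hd := natDegree_eq_of_derivative_mul_eq (sub_ne_zero.2 hne) hh (by
    rw [map_sub, derivative_smul, sub_mul, mul_sub, hw, smul_mul_assoc, mul_smul_comm])
  refine leadingCoeff_ne_zero.2 (sub_ne_zero.2 hne) ?_
  rw [leadingCoeff, hd, coeff_sub, coeff_smul, ← hgh, coeff_natDegree, hgh, coeff_natDegree, hc,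
    smul_eq_mul, div_mul_cancel₀ _ (leadingCoeff_ne_zero.2 hh), sub_self]

variable {K B : Type*} [Field K] [Ring B] [Algebra K B]

theorem adMap_pow_mul_eq_add {p a b : B} {m n : ℕ} (ha : (adMap K p ^ (m + 2)) a = 0)
    (hb : (adMap K p ^ (n + 2)) b = 0) :
    (adMap K p ^ (m + n + 1)) (a * b) =
      (m + n + 1).choose m • ((adMap K p ^ m) a * (adMap K p ^ (n + 1)) b) +
      (m + n + 1).choose (m + 1) • ((adMap K p ^ (m + 1)) a * (adMap K p ^ n) b) := by
  rw [adMap_pow_mul]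
  refine Finset.sum_eq_add (m, n + 1) (m + 1, n) (by simp) (fun ij hij hne => ?_)
    (fun h => absurd (by simp; omega) h) (fun h => absurd (by simp; omega) h)
  rw [Finset.HasAntidiagonal.mem_antidiagonal] at hij
  rw [Ne, Ne, Prod.ext_iff, Prod.ext_iff] at hne
  simp only [not_and_or] at hne
  rcases le_or_gt (m + 2) ij.1 with h | h
  · rw [adMap_pow_eq_zero_of_le h ha, zero_mul, smul_zero]
  · rw [adMap_pow_eq_zero_of_le (by omega : n + 2 ≤ ij.2) hb, mul_zero, smul_zero]

namespace IsWeylPair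

variable {p q : B} (h : IsWeylPair K p q) [CharZero K] [Nontrivial B]

include h

/-- The leading coefficients of commuting elements have vanishing Poisson bracket. -/
theorem derivative_mul_of_commute {x a : B} {m n : ℕ} {f g : K[X]} (hxa : x * a = a * x)
    (hx : (adMap K p ^ (n + 1)) x = aeval p f) (ha : (adMap K p ^ (m + 1)) a = aeval p g) :
    (m + 1 : K[X]) * (derivative f * g) = (n + 1) * (derivative g * f) := by
  have hp : ∀ f : K[X], adMap K p (aeval p f) = 0 := fun f => by
    rw [adMap_apply, sub_eq_zero]
    simpa using congrArg (aeval p) (mul_comm X f)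
  have hcomm : ∀ f : K[X], Commute p (aeval p f) := fun f => sub_eq_zero.1 (hp f)
  have hx2 : (adMap K p ^ (n + 2)) x = 0 := by rw [adMap_pow_succ, hx, hp]
  have ha2 : (adMap K p ^ (m + 2)) a = 0 := by rw [adMap_pow_succ, ha, hp]
  have h1 := adMap_pow_mul_eq_add hx2 ha2
  have h2 := adMap_pow_mul_eq_add ha2 hx2
  rw [← hxa, add_comm m n, h1, hx, ha] at h2
  have e1 := aeval_mul_sub_mul_aeval (x := p) (v := (adMap K p ^ m) a) (w := aeval p g)
    (by rw [← ha, adMap_pow_succ, adMap_apply]) (hcomm g) f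
  have e2 := aeval_mul_sub_mul_aeval (x := p) (v := (adMap K p ^ n) x) (w := aeval p f)
    (by rw [← hx, adMap_pow_succ, adMap_apply]) (hcomm f) g
  have c1 : (n + m + 1).choose (m + 1) = (n + m + 1).choose n :=
    Nat.choose_symm_of_eq_add (by omega)
  have c2 : (n + m + 1).choose m = (n + m + 1).choose (n + 1) :=
    Nat.choose_symm_of_eq_add (by omega)
  have c3 : (n + m + 1).choose (n + 1) * (n + 1) = (n + m + 1).choose n * (m + 1) := by
    rw [Nat.choose_succ_right_eq]; congr 1; omega
  rw [c1, c2] at h2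
  have h3 : (n + m + 1).choose (n + 1) • (derivative f * g) =
      (n + m + 1).choose n • (derivative g * f) := by
    apply aeval_left_injective h.lie
    rw [map_nsmul, map_nsmul, map_mul, map_mul, ← e1, ← e2, smul_sub, smul_sub]
    rw [sub_eq_sub_iff_add_eq_add, add_comm, h2, add_comm]
  rw [nsmul_eq_mul, nsmul_eq_mul] at h3
  have c3' : ((n + m + 1).choose (n + 1) : K[X]) * (n + 1) = (n + m + 1).choose n * (m + 1) := by
    exact_mod_cast c3
  have c0 : ((n + m + 1).choose n : K[X]) ≠ 0 := by
    exact_mod_cast (Nat.choose_pos (by omega)).ne'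
  refine mul_left_cancel₀ c0 ?_
  linear_combination (n + 1 : K[X]) * h3 - derivative f * g * c3'

/-- In the centralizer of an element of positive degree, leading coefficients of a given degree
span a line. -/
theorem exists_adMap_pow_sub_smul {x a b : B} {m : ℕ} (hx : 0 < adDeg K p x)
    (hxa : x * a = a * x) (hxb : x * b = b * x) (ha : adDeg K p a ≤ m) (hb : adDeg K p b = m)
    (hb0 : b ≠ 0) : ∃ c : K, (adMap K p ^ m) (a - c • b) = 0 := by
  have hx0 : x ≠ 0 := by
    rintro rfl
    exact hx.ne' (map_zero (algebraMap K B) ▸ adDeg_algebraMap p (0 : K))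
  obtain ⟨f, hf⟩ := h.exists_adMap_pow_adDeg x
  obtain ⟨n, hn⟩ : ∃ n, adDeg K p x = n + 1 := ⟨_, (Nat.succ_pred_eq_of_pos hx).symm⟩
  rw [hn] at hf
  have pos : ∀ {a b : B} {m : ℕ}, x * a = a * x → x * b = b * x → adDeg K p a ≤ m + 1 →
      adDeg K p b = m + 1 → b ≠ 0 → ∃ c : K, (adMap K p ^ (m + 1)) (a - c • b) = 0 := by
    intro a b m hxa hxb ha hb hb0
    obtain ⟨g, hg⟩ := h.exists_aeval_of_commute (a := (adMap K p ^ (m + 1)) a) (by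
      rw [← adMap_pow_succ]; exact h.adMap_pow_eq_zero (by omega))
    obtain ⟨k, hk⟩ := h.exists_adMap_pow_adDeg b
    rw [hb] at hk
    have hk0 : k ≠ 0 := by
      rintro rfl
      exact adMap_pow_adDeg_ne_zero hb0 (by rw [hb, ← hk, map_zero])
    have hf0 : f ≠ 0 := by
      rintro rfl
      exact adMap_pow_adDeg_ne_zero hx0 (by rw [hn, ← hf, map_zero])
    have e1 := h.derivative_mul_of_commute hxa hf.symm hg.symm
    have e2 := h.derivative_mul_of_commute hxb hf.symm hk.symm
    have hn0 : (n + 1 : K[X]) ≠ 0 := by exact_mod_cast n.succ_ne_zero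
    obtain ⟨c, rfl⟩ := exists_eq_smul_of_derivative_mul_eq (g := g) hk0
      (mul_left_cancel₀ (mul_ne_zero hn0 hf0) (by linear_combination g * e2 - k * e1))
    exact ⟨c, by rw [map_sub, map_smul, ← hg, ← hk, map_smul, sub_self]⟩
  rcases m with _ | m
  · have h1 := h.mul_ne_zero_and_adDeg hb0 hx0
    have h2 : adDeg K p (a * x) ≤ n + 1 := adDeg_le <| by
      refine adMap_pow_mul_eq_zero (m := 1) (n := n + 2) ?_ ?_ (by omega)
      · exact h.adMap_pow_eq_zero (by omega)
      · exact h.adMap_pow_eq_zero (by omega)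
    obtain ⟨c, hc⟩ := pos (a := a * x) (b := b * x) (m := n) (by rw [← mul_assoc, hxa])
      (by rw [← mul_assoc, hxb]) h2 (by omega) h1.1
    refine ⟨c, ?_⟩
    by_contra hne
    rw [pow_zero, Module.End.one_apply] at hne
    have h3 := h.mul_ne_zero_and_adDeg hne hx0
    rw [sub_mul, smul_mul_assoc] at h3
    have := adDeg_lt h3.1 hc
    omega
  · exact pos hxa hxb ha hb hb0

theorem adMap_pow_adMap_pow_sub (y a : B) (k : ℕ) :
    (adMap K p ^ (k * adDeg K p a + adDeg K p (adMap K y a)))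
      (adMap K y (a ^ (k + 1)) - (k + 1) • (a ^ k * adMap K y a)) = 0 := by
  set b := adMap K y a with hb
  have ha := h.adMap_pow_eq_zero (Nat.lt_succ_self (adDeg K p a))
  have hpow := h.adMap_pow_pow_eq_zero a
  induction k with
  | zero => simp [b]
  | succ k ih =>
    have e : adMap K y (a ^ (k + 1 + 1)) - (k + 1 + 1) • (a ^ (k + 1) * b) =
        (adMap K y (a ^ (k + 1)) - (k + 1) • (a ^ k * b)) * a +
          (k + 1) • (a ^ k * (b * a - a * b)) := by
      rw [pow_succ a (k + 1), adMap_mul, ← hb, pow_succ a k]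
      simp only [sub_mul, mul_sub, smul_mul_assoc, mul_assoc]
      module
    rw [e, map_add, map_nsmul,
      adMap_pow_mul_eq_zero ih ha (by rw [add_mul]; omega),
      adMap_pow_mul_eq_zero (hpow k) (h.adMap_pow_commutator b a) (by rw [add_mul]; omega),
      smul_zero, add_zero]

/-- For `a` with nonzero derivative under `ad y`, degrees behave as for a graded derivation. -/
theorem adMap_pow_adMap_pow_ne_zero {y a : B} (ha : adMap K y a ≠ 0) (k : ℕ) :
    (adMap K p ^ (k * adDeg K p a + adDeg K p (adMap K y a))) (adMap K y (a ^ (k + 1))) ≠ 0 := by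
  have ha0 : a ≠ 0 := by
    rintro rfl
    exact ha (map_zero _)
  have h1 := h.adMap_pow_adMap_pow_sub y a k
  rw [map_sub, sub_eq_zero] at h1
  have h2 := h.mul_ne_zero_and_adDeg (h.adDeg_pow ha0 k).1 ha
  rw [(h.adDeg_pow ha0 k).2] at h2
  rw [h1, map_nsmul, ← h2.2, ← Nat.cast_smul_eq_nsmul K]
  exact smul_ne_zero (by exact_mod_cast k.succ_ne_zero) (adMap_pow_adDeg_ne_zero h2.1)

theorem adDeg_adMap_pow_le (y a : B) (k : ℕ) :
    adDeg K p (adMap K y (a ^ (k + 1))) ≤ k * adDeg K p a + adDeg K p (adMap K y a) := by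
  refine adDeg_le ?_
  rw [← sub_add_cancel (adMap K y (a ^ (k + 1))) ((k + 1) • (a ^ k * adMap K y a)), map_add,
    adMap_pow_eq_zero_of_le (Nat.le_succ _) (h.adMap_pow_adMap_pow_sub y a k), map_nsmul,
    adMap_pow_mul_eq_zero (h.adMap_pow_pow_eq_zero a k)
      (h.adMap_pow_eq_zero (Nat.lt_succ_self _)) (by omega), smul_zero, add_zero]

theorem exists_algebraMap_of_adDeg_eq_zero {x a : B} (hx : 0 < adDeg K p x)
    (hxa : x * a = a * x) (ha : adDeg K p a = 0) : ∃ c : K, a = algebraMap K B c := by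
  obtain ⟨c, hc⟩ := h.exists_adMap_pow_sub_smul hx hxa (by simp) ha.le
    (map_one (algebraMap K B) ▸ adDeg_algebraMap p (1 : K)) one_ne_zero
  rw [pow_zero, Module.End.one_apply, sub_eq_zero] at hc
  exact ⟨c, by rw [hc, Algebra.algebraMap_eq_smul_one]⟩

/-- On the centralizer of `x`, where `[x, y] = 1`, the derivation `ad y` lowers degrees by exactly
the degree of `x`. -/
theorem adMap_ne_zero_and_adDeg_add {x y a : B} (hxy : x * y - y * x = 1)
    (hx : 0 < adDeg K p x) (hxa : x * a = a * x) (ha : 0 < adDeg K p a) :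
    adMap K y a ≠ 0 ∧ adDeg K p (adMap K y a) + adDeg K p x = adDeg K p a := by
  have hyx : adMap K y x = -1 := by rw [adMap_apply, ← hxy, neg_sub]
  obtain ⟨e, ⟨b, hxb, hb, rfl⟩, hmax⟩ := Int.exists_greatest_of_bdd
    (P := fun z => ∃ a, x * a = a * x ∧ adMap K y a ≠ 0 ∧
      z = (adDeg K p (adMap K y a) : ℤ) - adDeg K p a)
    ⟨adDeg K p y, by
      rintro _ ⟨a, -, -, rfl⟩
      have := h.adDeg_adMap_le y a
      omega⟩
    ⟨_, x, rfl, by rw [hyx]; exact neg_ne_zero.2 one_ne_zero, rfl⟩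
  have hmax' : ∀ {a : B}, x * a = a * x → adMap K y a ≠ 0 →
      adDeg K p (adMap K y a) + adDeg K p b ≤ adDeg K p (adMap K y b) + adDeg K p a := by
    intro a h1 h2
    have := hmax _ ⟨a, h1, h2, rfl⟩
    omega
  have hb0 : b ≠ 0 := by
    rintro rfl
    exact hb (map_zero _)
  obtain ⟨l, hl⟩ : ∃ l, adDeg K p b = l + 1 := by
    refine Nat.exists_eq_succ_of_ne_zero fun h0 => hb ?_
    obtain ⟨c, rfl⟩ := h.exists_algebraMap_of_adDeg_eq_zero hx hxb h0
    rw [adMap_apply, Algebra.commutes, sub_self]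
  have key : ∀ {a : B}, x * a = a * x → 0 < adDeg K p a → adMap K y a ≠ 0 ∧
      adDeg K p (adMap K y a) + adDeg K p b = adDeg K p (adMap K y b) + adDeg K p a := by
    intro a hxa ha
    obtain ⟨k, hk⟩ : ∃ k, adDeg K p a = k + 1 := ⟨_, (Nat.succ_pred_eq_of_pos ha).symm⟩
    have ha0 : a ≠ 0 := by
      rintro rfl
      exact ha.ne' (map_zero (algebraMap K B) ▸ adDeg_algebraMap p (0 : K))
    have hxa' : x * a ^ (l + 1) = a ^ (l + 1) * x := (Commute.pow_right hxa _)
    have hxb' : x * b ^ (k + 1) = b ^ (k + 1) * x := (Commute.pow_right hxb _)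
    have hda := h.adDeg_pow ha0 (l + 1)
    have hdb := h.adDeg_pow hb0 (k + 1)
    rw [hk] at hda
    rw [hl, mul_comm] at hdb
    obtain ⟨c, hc⟩ := h.exists_adMap_pow_sub_smul hx hxb' hxa' hdb.2.le hda.2 hda.1
    set r := b ^ (k + 1) - c • a ^ (l + 1) with hr
    have hxr : x * r = r * x := by
      rw [hr, mul_sub, sub_mul, hxb', mul_smul_comm, hxa', smul_mul_assoc]
    have hrT : (adMap K p ^ (k * adDeg K p b + adDeg K p (adMap K y b))) (adMap K y r) = 0 := by
      by_cases hyr : adMap K y r = 0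
      · rw [hyr, map_zero]
      · have hr0 : r ≠ 0 := fun h0 => hyr (by rw [h0, map_zero])
        have h1 := adDeg_lt hr0 hc
        have h2 := hmax' hxr hyr
        refine h.adMap_pow_eq_zero ?_
        rw [hl] at h2 ⊢
        have : (l + 1) * (k + 1) = k * (l + 1) + (l + 1) := by ring
        omega
    have hbT := h.adMap_pow_adMap_pow_ne_zero hb k
    have hbr : b ^ (k + 1) = r + c • a ^ (l + 1) := by rw [hr, sub_add_cancel]
    rw [hbr, map_add, map_add, hrT, zero_add, map_smul, map_smul] at hbT
    have haT := right_ne_zero_of_smul hbT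
    have hya : adMap K y a ≠ 0 := by
      intro h0
      refine haT ?_
      have : adMap K y (a ^ (l + 1)) = 0 := by
        rw [adMap_apply, sub_eq_zero] at h0 ⊢
        exact Commute.pow_right h0 _
      rw [this, map_zero]
    refine ⟨hya, le_antisymm (hmax' hxa hya) ?_⟩
    have h1 := h.adDeg_adMap_pow_le y a l
    by_contra! hlt
    refine haT (h.adMap_pow_eq_zero (h1.trans_lt ?_))
    rw [hl, hk] at hlt ⊢
    nlinarith
  have h1 := key (a := x) rfl hx
  have h2 := key hxa ha
  have h3 : adDeg K p (adMap K y x) = 0 := by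
    rw [hyx]
    simpa using adDeg_algebraMap p (-1 : K)
  exact ⟨h2.1, by omega⟩

theorem exists_aeval_of_commute_of_pos {x y a : B} (hxy : x * y - y * x = 1)
    (hx : 0 < adDeg K p x) (hxa : x * a = a * x) : ∃ f : K[X], aeval x f = a := by
  have hx0 : x ≠ 0 := by
    rintro rfl
    exact hx.ne' (map_zero (algebraMap K B) ▸ adDeg_algebraMap p (0 : K))
  have hdvd : ∀ n, ∀ a : B, adDeg K p a = n → x * a = a * x → adDeg K p x ∣ n := by
    intro n
    induction n using Nat.strong_induction_on with
    | _ n ih =>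
      intro a han hxa
      rcases Nat.eq_zero_or_pos n with rfl | hn
      · exact dvd_zero _
      · obtain ⟨-, h2⟩ := h.adMap_ne_zero_and_adDeg_add hxy hx hxa (by omega)
        rw [han] at h2
        have hxy' : y * x = x * y - 1 := by rw [← hxy]; abel
        have hcomm : x * adMap K y a = adMap K y a * x := by
          rw [adMap_apply, ← sub_eq_zero]
          have : x * (y * a - a * y) - (y * a - a * y) * x =
              (x * y - y * x) * a - a * (x * y - y * x) + y * (x * a - a * x) -
                (x * a - a * x) * y := by noncomm_ring
          rw [this, hxy, hxa]; simp
        have := ih _ (by omega) _ rfl hcomm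
        rw [← h2]
        exact (Nat.dvd_add_right this).2 dvd_rfl
  induction hn : adDeg K p a using Nat.strong_induction_on generalizing a with
  | _ n ih =>
    obtain ⟨k, hk⟩ := hdvd n a hn hxa
    obtain ⟨c, hc⟩ := h.exists_adMap_pow_sub_smul hx hxa (Commute.self_pow x k) hn.le
      (by rw [(h.adDeg_pow hx0 k).2, hk, mul_comm]) (h.adDeg_pow hx0 k).1
    have hred : ∃ f : K[X], aeval x f = a - c • x ^ k := by
      by_cases h0 : a - c • x ^ k = 0
      · exact ⟨0, by rw [h0, map_zero]⟩
      · refine ih _ (adDeg_lt h0 hc) ?_ rfl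
        rw [mul_sub, sub_mul, hxa, mul_smul_comm, smul_mul_assoc, (Commute.self_pow x k).eq]
    obtain ⟨f, hf⟩ := hred
    exact ⟨f + c • X ^ k, by rw [map_add, hf]; simp⟩

/-- If `[x, y] = 1` in the Weyl algebra, then the centralizer of `x` is `K[x]`. -/
theorem exists_aeval_of_lie_eq_one {x y a : B} (hxy : x * y - y * x = 1)
    (hxa : x * a = a * x) : ∃ f : K[X], aeval x f = a := by
  rcases Nat.eq_zero_or_pos (adDeg K p x) with hp | hp
  · rcases Nat.eq_zero_or_pos (adDeg K q x) with hq | hq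
    · exfalso
      have h1 := h.adMap_pow_eq_zero (a := x) (n := 1) (by omega)
      have h2 := h.symm.adMap_pow_eq_zero (a := x) (n := 1) (by omega)
      rw [pow_one, adMap_apply, sub_eq_zero] at h1 h2
      have hle : Algebra.adjoin K {p, q} ≤ Subalgebra.centralizer K {x} := by
        refine Algebra.adjoin_le ?_
        rintro _ (rfl | rfl) _ rfl
        · exact h1.symm
        · exact h2.symm
      have hy : y ∈ Subalgebra.centralizer K {x} := hle (h.adjoin ▸ trivial)
      have := hy x rfl
      rw [this, sub_self] at hxy
      exact zero_ne_one hxy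
    · exact h.symm.exists_aeval_of_commute_of_pos hxy hq hxa
  · exact h.exists_aeval_of_commute_of_pos hxy hp hxa

/-- If `[x, y] = 1` and `ad x` is locally nilpotent, then `x` and `y` generate the Weyl algebra. -/
theorem adjoin_eq_top {x y : B} (hxy : x * y - y * x = 1)
    (hN : ∀ a, ∃ n, (adMap K x ^ n) a = 0) : Algebra.adjoin K {x, y} = ⊤ := by
  have hxS : x ∈ Algebra.adjoin K {x, y} := Algebra.subset_adjoin (by simp)
  have hyS : y ∈ Algebra.adjoin K {x, y} := Algebra.subset_adjoin (by simp)
  have key : ∀ n, ∀ a : B, (adMap K x ^ n) a = 0 → a ∈ Algebra.adjoin K {x, y} := by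
    intro n
    induction n with
    | zero =>
      intro a ha
      rw [pow_zero, Module.End.one_apply] at ha
      exact ha ▸ zero_mem _
    | succ n ih =>
      intro a ha
      set b := (adMap K x ^ n) a with hb
      have hxb : adMap K x b = 0 := by rw [hb, ← adMap_pow_succ, ha]
      obtain ⟨f, hf⟩ := h.exists_aeval_of_lie_eq_one hxy (sub_eq_zero.1 hxb)
      have hbS : b ∈ Algebra.adjoin K {x, y} := by
        have hle := Algebra.adjoin_mono (R := K) (s := {x}) (t := {x, y}) (by simp)
        exact hle (Algebra.adjoin_singleton_eq_range_aeval K x ▸ ⟨f, hf⟩)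
      have hyn : (adMap K x ^ n) (y ^ n) = (n.factorial : K) • (1 : B) := by
        have := adMap_pow_orderedEval (K := K) hxy n (X ^ n)
        rw [← monomial_one_right_eq_X_pow, orderedEval_monomial, map_one, one_mul,
          monomial_one_right_eq_X_pow, iterate_derivative_X_pow_eq_smul, Nat.sub_self, pow_zero,
          Nat.descFactorial_self] at this
        rw [this, ← C_1, smul_C, orderedEval_C]
        simp [Algebra.smul_def]
      have hbyn : (adMap K x ^ n) (b * y ^ n) = (n.factorial : K) • b := by
        have hy1 : (adMap K x ^ (n + 1)) (y ^ n) = 0 := by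
          rw [adMap_pow_succ, hyn, map_smul]; simp
        have := adMap_pow_add_mul (m := 0) (by simpa using hxb) hy1
        rw [zero_add, hyn] at this
        simpa using this
      have hn0 : (n.factorial : K) ≠ 0 := by exact_mod_cast n.factorial_ne_zero
      have hmem := ih (a - (n.factorial : K)⁻¹ • (b * y ^ n)) (by
        rw [map_sub, map_smul, hbyn, smul_smul, inv_mul_cancel₀ hn0, one_smul, sub_self])
      have := add_mem hmem (Subalgebra.smul_mem _ (mul_mem hbS (pow_mem hyS n))
        (n.factorial : K)⁻¹)
      rwa [sub_add_cancel] at this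
  exact eq_top_iff.2 fun a _ => (hN a).elim fun n hn => key n a hn

end IsWeylPair

end Centralizer

section Eigenvector

variable {K B : Type*} [Field K] [Ring B] [Algebra K B]

theorem adMap_sub_smul_pow_mul {x a : B} {μ : K} (ha : adMap K x a = μ • a) (u : B)
    (n : ℕ) : ((adMap K x - μ • 1) ^ n) (u * a) = (adMap K x ^ n) u * a := by
  induction n with
  | zero => simp
  | succ n ih =>
    rw [pow_succ', Module.End.mul_apply, ih, adMap_pow_succ, LinearMap.sub_apply, adMap_mul, ha,
      LinearMap.smul_apply, Module.End.one_apply, mul_smul_comm, add_sub_cancel_right]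

theorem adMap_pow_of_adMap_eq_smul {x a : B} {μ : K} (ha : adMap K x a = μ • a) (n : ℕ) :
    adMap K x (a ^ n) = ((n : K) * μ) • a ^ n := by
  induction n with
  | zero => simp
  | succ n ih =>
    rw [pow_succ, adMap_mul, ih, ha, smul_mul_assoc, mul_smul_comm, ← add_smul]
    push_cast
    ring_nf

namespace IsWeylPair

variable {p q : B} (h : IsWeylPair K p q) [CharZero K] [Nontrivial B]

include h

theorem linearIndependent_monomial_mul_pow {x y a : B} (hxy : x * y - y * x = 1) {μ : K}
    (hμ : μ ≠ 0) (ha : adMap K x a = μ • a) (ha0 : a ≠ 0) (N : ℕ) :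
    LinearIndependent K fun i : Fin N × Fin N × Fin N =>
      x ^ (i.2.1 : ℕ) * y ^ (i.2.2 : ℕ) * a ^ (i.1 : ℕ) := by
  have := h.noZeroDivisors
  rw [Fintype.linearIndependent_iff]
  intro c hc
  set f : Fin N → K[X][X] := fun k =>
    ∑ j : Fin N, monomial (j : ℕ) (∑ i : Fin N, monomial (i : ℕ) (c (k, i, j))) with hf
  have heval : ∀ k, orderedEval K x y (f k) =
      ∑ i : Fin N, ∑ j : Fin N, c (k, i, j) • (x ^ (i : ℕ) * y ^ (j : ℕ)) := by
    intro k
    rw [Finset.sum_comm]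
    rw [hf, orderedEval, eval₂_finsetSum]
    refine Finset.sum_congr rfl fun j _ => ?_
    rw [eval₂_monomial, RingHom.coe_coe, map_sum, Finset.sum_mul]
    refine Finset.sum_congr rfl fun i _ => ?_
    rw [aeval_monomial, ← Algebra.smul_def, smul_mul_assoc]
  have hsum : ∑ k : Fin N, orderedEval K x y (f k) * a ^ (k : ℕ) = 0 := by
    rw [← hc, Fintype.sum_prod_type]
    refine Finset.sum_congr rfl fun k _ => ?_
    rw [heval, Fintype.sum_prod_type, Finset.sum_mul]
    refine Finset.sum_congr rfl fun i _ => ?_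
    rw [Finset.sum_mul]
    exact Finset.sum_congr rfl fun j _ => smul_mul_assoc ..
  have hinj : Function.Injective fun k : Fin N => ((k : ℕ) : K) * μ := fun k l hkl =>
    Fin.ext (by exact_mod_cast mul_right_cancel₀ hμ hkl)
  have hind := (Module.End.independent_maxGenEigenspace (adMap K x)).comp hinj
  rw [iSupIndep_iff_finsetSum_eq_zero_imp_eq_zero] at hind
  have hzero : ∀ k : Fin N, orderedEval K x y (f k) * a ^ (k : ℕ) = 0 := fun k =>
    hind Finset.univ (fun k => orderedEval K x y (f k) * a ^ (k : ℕ)) (fun k _ => by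
      refine Module.End.mem_maxGenEigenspace _ _ _ |>.2 ⟨(f k).natDegree + 1, ?_⟩
      rw [adMap_sub_smul_pow_mul (adMap_pow_of_adMap_eq_smul ha k), adMap_pow_orderedEval hxy,
        iterate_derivative_eq_zero (Nat.lt_succ_self _), orderedEval_zero, zero_mul]) hsum k
      (Finset.mem_univ k)
  rintro ⟨k, i, j⟩
  have hfk : f k = 0 := by
    by_contra hne
    exact mul_ne_zero (orderedEval_ne_zero hxy hne) (pow_ne_zero _ ha0) (hzero k)
  have := congrArg (fun g => (g.coeff j).coeff i) hfk
  simpa [hf, coeff_monomial, Fin.val_inj, finsetSum_coeff, Finset.sum_ite_eq] using this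

/-- A solvable element has no eigenvectors of nonzero eigenvalue: otherwise `B` would have
at least cubic growth. -/
theorem commute_of_adMap_eq_smul {x y a : B} (hxy : x * y - y * x = 1) {μ : K}
    (ha : adMap K x a = μ • a) : adMap K x a = 0 := by
  by_contra hne
  have hμ : μ ≠ 0 := by
    rintro rfl
    exact hne (by rw [ha, zero_smul])
  have ha0 : a ≠ 0 := by
    rintro rfl
    exact hne (map_zero _)
  obtain ⟨cx, hx⟩ := h.exists_mem_boxSpan x
  obtain ⟨cy, hy⟩ := h.exists_mem_boxSpan y
  obtain ⟨ca, hca⟩ := h.exists_mem_boxSpan a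
  set c := cx + cy + ca
  replace hx : x ∈ boxSpan K p q c := boxSpan_mono p q (by omega) hx
  replace hy : y ∈ boxSpan K p q c := boxSpan_mono p q (by omega) hy
  replace hca : a ∈ boxSpan K p q c := boxSpan_mono p q (by omega) hca
  have h1 : (1 : B) ∈ boxSpan K p q 0 := by
    simpa using monomial_mem_boxSpan (K := K) p q (le_refl 0) (le_refl 0)
  set N := (6 * c + 1) ^ 2 + 1 with hN
  have hli := h.linearIndependent_monomial_mul_pow hxy hμ ha ha0 N
  have hle : Submodule.span K (Set.range fun i : Fin N × Fin N × Fin N =>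
      x ^ (i.2.1 : ℕ) * y ^ (i.2.2 : ℕ) * a ^ (i.1 : ℕ)) ≤ boxSpan K p q (6 * c * N) := by
    rw [Submodule.span_le]
    rintro _ ⟨⟨k, i, j⟩, rfl⟩
    have h2 := mul_pow_mem_boxSpan h.lie
      (mul_pow_mem_boxSpan h.lie (mul_pow_mem_boxSpan h.lie h1 hx i) hy j) hca k
    rw [one_mul] at h2
    refine boxSpan_mono p q ?_ h2
    have hi := Nat.mul_le_mul_left (2 * c) i.2.le
    have hj := Nat.mul_le_mul_left (2 * c) j.2.le
    have hk := Nat.mul_le_mul_left (2 * c) k.2.le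
    linarith
  have hcard := (finrank_span_eq_card hli).symm.le.trans
    ((Submodule.finrank_mono hle).trans (finrank_boxSpan_le p q _))
  simp only [Fintype.card_prod, Fintype.card_fin] at hcard
  have hN1 : 1 ≤ N := by omega
  have h3 : 6 * c * N + 1 ≤ (6 * c + 1) * N := by rw [add_mul]; omega
  have h4 : N * (N * N) ≤ ((6 * c + 1) ^ 2) * (N * N) := by
    calc _ ≤ _ := hcard
      _ ≤ ((6 * c + 1) * N) ^ 2 := Nat.pow_le_pow_left h3 2
      _ = _ := by ring
  have := Nat.le_of_mul_le_mul_right h4 (by positivity)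
  omega

end IsWeylPair

end Eigenvector

section WeylAlgebra

variable {K : Type*} [Field K]

theorem exists_algHom_of_lie_eq_one {B : Type*} [Ring B] [Algebra K B] {x y : B}
    (h : x * y - y * x = 1) :
    ∃ φ : WeylAlgebra K →ₐ[K] B, φ (Wp K) = x ∧ φ (Wq K) = y := by
  refine ⟨RingQuot.liftAlgHom K ⟨FreeAlgebra.lift K ![x, y], ?_⟩, ?_, ?_⟩
  · rintro _ _ ⟨⟩
    simpa [sub_eq_iff_eq_add'] using h
  · simp [Wp]
  · simp [Wq]

theorem Wp_mul_Wq_sub : Wp K * Wq K - Wq K * Wp K = 1 := by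
  have := RingQuot.mkAlgHom_rel K (WeylRel.comm (F := K))
  simp only [map_mul, map_add, map_one] at this
  rw [Wp, Wq, this, add_sub_cancel_left]

theorem isWeylPair_Wp_Wq : IsWeylPair K (Wp K) (Wq K) where
  lie := Wp_mul_Wq_sub
  adjoin := by
    have h1 := congrArg (Subalgebra.map (RingQuot.mkAlgHom K (WeylRel K)))
      (FreeAlgebra.adjoin_range_ι K (Fin 2))
    rw [AlgHom.map_adjoin, Algebra.map_top,
      (AlgHom.range_eq_top _).2 (RingQuot.mkAlgHom_surjective K (WeylRel K))] at h1
    rw [← h1, ← Set.range_comp]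
    congr 1
    ext z
    simp [Fin.exists_fin_two, Wp, Wq, eq_comm]

instance : Nontrivial (WeylAlgebra K) := by
  obtain ⟨φ, -⟩ := exists_algHom_of_lie_eq_one (K := K) (B := Module.End K K[X])
    (x := derivative) (y := LinearMap.mulLeft K X) (by
      refine LinearMap.ext fun f => ?_
      simp [derivative_mul])
  exact φ.toRingHom.domain_nontrivial

theorem mem_Nset_iff {x a : WeylAlgebra K} : a ∈ Nset K x ↔ ∃ n, (adMap K x ^ n) a = 0 := by
  have key : ∀ n, (fun z => x * z - z * x)^[n] a = (adMap K x ^ n) a := fun n => by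
    rw [Module.End.pow_apply]; rfl
  exact ⟨fun ⟨n, _, hn⟩ => ⟨n, (key n).symm.trans hn⟩, fun ⟨n, hn⟩ => ⟨n + 1,
    Nat.le_add_left .., (key _).trans (adMap_pow_eq_zero_of_le n.le_succ hn)⟩⟩

theorem Solvable.notMem_range {x : WeylAlgebra K} (hx : Solvable K x) :
    x ∉ Set.range (algebraMap K (WeylAlgebra K)) := by
  rintro ⟨c, rfl⟩
  obtain ⟨y, hy⟩ := hx
  rw [Algebra.commutes, sub_self] at hy
  exact zero_ne_one hy

theorem Nset_map_Wp_eq_univ {φ : WeylAlgebra K →ₐ[K] WeylAlgebra K}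
    (hφ : Function.Surjective φ) : Nset K (φ (Wp K)) = Set.univ := by
  have key : ∀ n a, (adMap K (φ (Wp K)) ^ n) (φ a) = φ ((adMap K (Wp K) ^ n) a) := by
    intro n a
    induction n with
    | zero => simp
    | succ n ih => simp [adMap_pow_succ, ih]
  refine Set.eq_univ_of_forall fun b => mem_Nset_iff.2 ?_
  obtain ⟨a, rfl⟩ := hφ b
  obtain ⟨n, hn⟩ := isWeylPair_Wp_Wq.exists_adMap_pow_eq_zero a
  exact ⟨n, by rw [key, hn, map_zero]⟩

variable {F}

theorem Dset_eq_Cset {x : WeylAlgebra F} (hx : Solvable F x) : Dset F x = Cset F x := by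
  obtain ⟨y, hxy⟩ := hx
  ext a
  refine ⟨fun ⟨c, hc⟩ => isWeylPair_Wp_Wq.commute_of_adMap_eq_smul hxy hc, fun ha => ⟨0, ?_⟩⟩
  rw [zero_smul]
  exact ha

theorem Solvable.mem_Delta1_iff {x : WeylAlgebra F} (hx : Solvable F x) :
    x ∈ Delta1 F ↔ Nset F x = Set.univ :=
  ⟨fun h => h.2.1, fun h => ⟨hx.notMem_range, h, Dset_eq_Cset hx⟩⟩

theorem Solvable.mem_Delta2_iff {x : WeylAlgebra F} (hx : Solvable F x) :
    x ∈ Delta2 F ↔ Nset F x ≠ Set.univ := by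
  refine ⟨fun h => h.2.1, fun h => ⟨hx.notMem_range, h, fun hNC => ?_, Dset_eq_Cset hx⟩⟩
  obtain ⟨y, hy⟩ := hx
  have hyN : y ∈ Nset F x := mem_Nset_iff.2 ⟨2, by
    rw [adMap_pow_succ, pow_one, show adMap F x y = 1 from hy, adMap_apply, mul_one,
      one_mul, sub_self]⟩
  rw [hNC] at hyN
  exact zero_ne_one (hyN.symm.trans hy)

theorem injective_algHom_WeylAlgebra (φ : WeylAlgebra F →ₐ[F] WeylAlgebra F) :
    Function.Injective φ := by
  have h : φ (Wp F) * φ (Wq F) - φ (Wq F) * φ (Wp F) = 1 := by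
    rw [← map_mul, ← map_mul, ← map_sub, Wp_mul_Wq_sub, map_one]
  refine (injective_iff_map_eq_zero φ).2 fun a ha => ?_
  obtain ⟨f, rfl⟩ := isWeylPair_Wp_Wq.exists_orderedEval a
  have hmap : φ (orderedEval F (Wp F) (Wq F) f) = orderedEval F (φ (Wp F)) (φ (Wq F)) f := by
    clear ha
    induction f using Polynomial.induction_on' with
    | add f g hf hg => rw [orderedEval_add, map_add, hf, hg, orderedEval_add]
    | monomial n f => simp only [orderedEval_monomial, map_mul, map_pow, aeval_algHom_apply]
  by_contra hne
  refine orderedEval_ne_zero h (f := f) ?_ (hmap ▸ ha)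
  rintro rfl
  exact hne (orderedEval_zero ..)

theorem surjective_algHom_WeylAlgebra {φ : WeylAlgebra F →ₐ[F] WeylAlgebra F}
    (hN : Nset F (φ (Wp F)) = Set.univ) : Function.Surjective φ := by
  have h : φ (Wp F) * φ (Wq F) - φ (Wq F) * φ (Wp F) = 1 := by
    rw [← map_mul, ← map_mul, ← map_sub, Wp_mul_Wq_sub, map_one]
  have htop := isWeylPair_Wp_Wq.adjoin_eq_top h fun a =>
    mem_Nset_iff.1 (hN ▸ Set.mem_univ a)
  rw [← AlgHom.range_eq_top, eq_top_iff, ← htop, Algebra.adjoin_le_iff]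
  rintro _ (rfl | rfl)
  exacts [⟨_, rfl⟩, ⟨_, rfl⟩]

end WeylAlgebra

/-- Theorem 3.8. -/
theorem endo_auto_iff_solvable_strictly_nilpotent :
    ((∀ φ : WeylAlgebra F →ₐ[F] WeylAlgebra F, Function.Bijective φ) ↔
      (∀ x : WeylAlgebra F, Solvable F x → x ∈ Delta1 F)) ∧
    ((∀ x : WeylAlgebra F, Solvable F x → x ∈ Delta1 F) ↔
      (∀ x ∈ Delta2 F, ¬ Solvable F x)) := by
  refine ⟨⟨fun hbij x hx => ?_, fun hsol φ => ⟨injective_algHom_WeylAlgebra φ, ?_⟩⟩,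
    fun hsol x hx2 hx => hx2.2.1 (hsol x hx).2.1, fun hsol x hx => ?_⟩
  · obtain ⟨y, hy⟩ := id hx
    obtain ⟨φ, rfl, -⟩ := exists_algHom_of_lie_eq_one (K := F) hy
    exact hx.mem_Delta1_iff.2 (Nset_map_Wp_eq_univ (hbij φ).2)
  · refine surjective_algHom_WeylAlgebra (hsol _ ⟨φ (Wq F), ?_⟩).2.1
    rw [← map_mul, ← map_mul, ← map_sub, Wp_mul_Wq_sub, map_one]
  · by_contra hne
    exact hsol x (hx.mem_Delta2_iff.2 fun h => hne (hx.mem_Delta1_iff.2 h)) hx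
end

section
/- Let x = x_s + x_{s+1} + ⋯ + x_t with x_i ∈ A_i (s, t ∈ ℤ). If x_t ≠ 0, t > 1, and C(x_t) = F[x_t], or if x_s ≠ 0, s < −1, and C(x_s) = F[x_s], then x is unsolvable. (Theorem 4.2) -/
open scoped BigOperators

variable (F : Type*) [Field F] [CharZero F]

section Graded

variable {K A : Type*} [Field K] [Ring A] [Algebra K A]

/-- The sum of all components of degree at most `m`. -/
def degreeLE (G : ℤ → Submodule K A) (m : ℤ) : Submodule K A :=
  ⨆ (i : ℤ) (_ : i ≤ m), G i

lemma le_degreeLE (G : ℤ → Submodule K A) {i m : ℤ} (h : i ≤ m) : G i ≤ degreeLE G m :=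
  le_iSup₂_of_le i h le_rfl

lemma degreeLE_mono (G : ℤ → Submodule K A) {m n : ℤ} (h : m ≤ n) :
    degreeLE G m ≤ degreeLE G n :=
  iSup₂_le fun _ hi => le_degreeLE G (hi.trans h)

lemma degreeLE_le_sup (G : ℤ → Submodule K A) (m : ℤ) :
    degreeLE G m ≤ G m ⊔ degreeLE G (m - 1) := by
  refine iSup₂_le fun i hi => ?_
  rcases eq_or_lt_of_le hi with rfl | h
  · exact le_sup_left
  · exact (le_degreeLE G (by omega)).trans le_sup_right

lemma exists_mem_degreeLE (G : ℤ → Submodule K A) (htop : ⨆ i, G i = ⊤) (y : A) :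
    ∃ m, y ∈ degreeLE G m := by
  have hy : y ∈ ⨆ i, G i := htop ▸ Submodule.mem_top
  induction hy using Submodule.iSup_induction' with
  | mem i y hy => exact ⟨i, le_degreeLE G le_rfl hy⟩
  | zero => exact ⟨0, zero_mem _⟩
  | add y z _ _ hy hz =>
    obtain ⟨m, hm⟩ := hy
    obtain ⟨n, hn⟩ := hz
    exact ⟨max m n, add_mem (degreeLE_mono G (le_max_left _ _) hm)
      (degreeLE_mono G (le_max_right _ _) hn)⟩

/-- Linear projections onto the components of a grading. -/
structure GradedProj (G : ℤ → Submodule K A) where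
  /-- The projection onto the component of degree `i`. -/
  proj : ℤ → A →ₗ[K] A
  proj_same : ∀ i y, y ∈ G i → proj i y = y
  proj_ne : ∀ i j y, y ∈ G i → i ≠ j → proj j y = 0

lemma GradedProj.proj_degreeLE {G : ℤ → Submodule K A} (P : GradedProj G) {m n : ℤ} {y : A}
    (hy : y ∈ degreeLE G m) (h : m < n) : P.proj n y = 0 := by
  have : degreeLE G m ≤ LinearMap.ker (P.proj n) :=
    iSup₂_le fun i hi z hz => P.proj_ne i n z hz (by omega)
  exact this hy

lemma nonempty_gradedProj (G : ℤ → Submodule K A) (hind : iSupIndep G) (htop : ⨆ i, G i = ⊤) :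
    Nonempty (GradedProj G) := by
  classical
  have hint : DirectSum.IsInternal G :=
    DirectSum.isInternal_submodule_of_iSupIndep_of_iSup_eq_top hind htop
  let := hint.chooseDecomposition
  exact ⟨{
    proj := fun i => (G i).subtype ∘ₗ DirectSum.component K ℤ (fun i => G i) i ∘ₗ
      (DirectSum.decomposeLinearEquiv G).toLinearMap
    proj_same := fun i y hy => DirectSum.decompose_of_mem_same G hy
    proj_ne := fun i j y hy h => DirectSum.decompose_of_mem_ne G hy h }⟩

variable (G : ℤ → Submodule K A) [SetLike.GradedMonoid G]

lemma mul_mem_degreeLE {m n k : ℤ} {y z : A} (hy : y ∈ degreeLE G m) (hz : z ∈ degreeLE G n)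
    (hk : m + n ≤ k) : y * z ∈ degreeLE G k := by
  have h : degreeLE G m * degreeLE G n ≤ degreeLE G k := by
    simp only [degreeLE, Submodule.iSup_mul, Submodule.mul_iSup, iSup_le_iff]
    intro i hi j hj
    refine Submodule.mul_le.2 fun u hu v hv => ?_
    exact le_degreeLE G (by omega : j + i ≤ k) (SetLike.mul_mem_graded hu hv)
  exact h (Submodule.mul_mem_mul hy hz)

/-- The degree `t + m` part of a commutator of elements of degrees at most `t` and `m`. -/
lemma GradedProj.proj_commutator {G : ℤ → Submodule K A} [SetLike.GradedMonoid G]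
    (P : GradedProj G) {t m : ℤ} {a r b c : A} (ha : a ∈ G t) (hr : r ∈ degreeLE G (t - 1))
    (hb : b ∈ G m) (hc : c ∈ degreeLE G (m - 1)) :
    P.proj (t + m) ((a + r) * (b + c) - (b + c) * (a + r)) = a * b - b * a := by
  have ha' := le_degreeLE G le_rfl ha
  have hb' := le_degreeLE G le_rfl hb
  have e : (a + r) * (b + c) - (b + c) * (a + r) =
      (a * b - b * a) + ((a * c + r * b + r * c) - (c * a + b * r + c * r)) := by
    noncomm_ring
  have h1 : a * b - b * a ∈ G (t + m) :=
    sub_mem (SetLike.mul_mem_graded ha hb) (add_comm m t ▸ SetLike.mul_mem_graded hb ha)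
  have h2 : (a * c + r * b + r * c) - (c * a + b * r + c * r) ∈ degreeLE G (t + m - 1) := by
    refine sub_mem (add_mem (add_mem ?_ ?_) ?_) (add_mem (add_mem ?_ ?_) ?_)
    · exact mul_mem_degreeLE G ha' hc (by omega)
    · exact mul_mem_degreeLE G hr hb' (by omega)
    · exact mul_mem_degreeLE G hr hc (by omega)
    · exact mul_mem_degreeLE G hc ha' (by omega)
    · exact mul_mem_degreeLE G hb' hr (by omega)
    · exact mul_mem_degreeLE G hc hr (by omega)
  rw [e, map_add, P.proj_same _ _ h1, P.proj_degreeLE h2 (by omega), add_zero]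

lemma pow_mem_graded_mul {t : ℤ} {a : A} (ha : a ∈ G t) (k : ℕ) : a ^ k ∈ G (k * t) := by
  simpa using SetLike.pow_mem_graded k ha

/-- A homogeneous polynomial expression in a homogeneous element of positive degree is a
monomial expression. -/
lemma GradedProj.exists_pow_of_aeval_mem {G : ℤ → Submodule K A} [SetLike.GradedMonoid G]
    (P : GradedProj G) {t m : ℤ} (ht : 0 < t) {a : A} (ha : a ∈ G t) (f : Polynomial K)
    (hf : Polynomial.aeval a f ∈ G m) :
    Polynomial.aeval a f = 0 ∨
      ∃ (c : K) (k : ℕ), k * t = m ∧ Polynomial.aeval a f = c • a ^ k := by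
  rw [← P.proj_same _ _ hf, Polynomial.aeval_eq_sum_range, map_sum]
  by_cases hk : ∃ k : ℕ, k * t = m
  · obtain ⟨k, hk⟩ := hk
    by_cases hkf : k ∈ Finset.range (f.natDegree + 1)
    · refine Or.inr ⟨f.coeff k, k, hk, ?_⟩
      rw [Finset.sum_eq_single_of_mem k hkf, map_smul,
        P.proj_same _ _ (hk ▸ pow_mem_graded_mul G ha k)]
      intro j _ hj
      rw [map_smul, P.proj_ne _ _ _ (pow_mem_graded_mul G ha j), smul_zero]
      rw [← hk]
      intro h
      exact hj (by exact_mod_cast mul_right_cancel₀ ht.ne' h)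
    · refine Or.inl (Finset.sum_eq_zero fun j hj => ?_)
      rw [map_smul, P.proj_ne _ _ _ (pow_mem_graded_mul G ha j), smul_zero]
      rw [← hk]
      intro h
      have : j = k := by exact_mod_cast mul_right_cancel₀ ht.ne' h
      exact hkf (this ▸ hj)
  · refine Or.inl (Finset.sum_eq_zero fun j _ => ?_)
    rw [map_smul, P.proj_ne _ _ _ (pow_mem_graded_mul G ha j) fun h => hk ⟨j, h⟩, smul_zero]

lemma add_pow_sub_pow_mem_degreeLE {t : ℤ} {a r : A} (ha : a ∈ G t)
    (hr : r ∈ degreeLE G (t - 1)) (k : ℕ) : (a + r) ^ k - a ^ k ∈ degreeLE G (k * t - 1) := by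
  induction k with
  | zero => simp
  | succ k ih =>
    have e : (a + r) ^ (k + 1) - a ^ (k + 1) =
        ((a + r) ^ k - a ^ k) * (a + r) + a ^ k * r := by
      rw [pow_succ, pow_succ]; noncomm_ring
    have hx : a + r ∈ degreeLE G t :=
      add_mem (le_degreeLE G le_rfl ha) (degreeLE_mono G (by omega) hr)
    rw [e]
    push_cast
    refine add_mem (mul_mem_degreeLE G ih hx (by linarith)) ?_
    exact mul_mem_degreeLE G (le_degreeLE G le_rfl (pow_mem_graded_mul G ha k)) hr (by linarith)

/-- If `a + r` is solvable and its leading part `a` generates its own centralizer, then the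
equation can be solved for `a` by a homogeneous element. -/
lemma GradedProj.exists_homogeneous_solution {G : ℤ → Submodule K A} [SetLike.GradedMonoid G]
    (P : GradedProj G) (htop : ⨆ i, G i = ⊤) {t : ℤ} (ht : 0 < t) {a r : A} (ha : a ∈ G t)
    (hr : r ∈ degreeLE G (t - 1))
    (hC : ∀ z, a * z - z * a = 0 → ∃ f : Polynomial K, Polynomial.aeval a f = z)
    {y : A} (hy : (a + r) * y - y * (a + r) = 1) :
    ∃ b ∈ G (-t), a * b - b * a = 1 := by
  have one_mem : (1 : A) ∈ G 0 := SetLike.GradedOne.one_mem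
  have key : ∀ (n : ℕ) (y : A), y ∈ degreeLE G (n - t) →
      (a + r) * y - y * (a + r) = 1 → ∃ b ∈ G (-t), a * b - b * a = 1 := by
    intro n
    induction n with
    | zero =>
      intro y hyL hy
      obtain ⟨b, hb, c, hc, rfl⟩ := Submodule.mem_sup.1 (degreeLE_le_sup G _ hyL)
      have h := P.proj_commutator ha hr hb hc
      rw [hy, P.proj_same _ _ (by simpa using one_mem)] at h
      exact ⟨b, by simpa using hb, h.symm⟩
    | succ n ih =>
      intro y hyL hy
      obtain ⟨b, hb, c, hc, rfl⟩ := Submodule.mem_sup.1 (degreeLE_le_sup G _ hyL)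
      have hc' : c ∈ degreeLE G (n - t) := by
        convert hc using 2; push_cast; ring
      have h := P.proj_commutator ha hr hb hc
      rw [hy, P.proj_ne _ _ _ one_mem (by push_cast; omega)] at h
      obtain ⟨f, rfl⟩ := hC b h.symm
      rcases P.exists_pow_of_aeval_mem ht ha f hb with h0 | ⟨d, k, hk, h0⟩
      · rw [h0, zero_add] at hy
        exact ih c hc' hy
      · rw [h0] at hy
        refine ih (c - d • ((a + r) ^ k - a ^ k)) (sub_mem hc' (Submodule.smul_mem _ _ ?_)) ?_
        · convert add_pow_sub_pow_mem_degreeLE G ha hr k using 2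
          rw [hk]; push_cast; ring
        · have hcomm : (a + r) * (a + r) ^ k = (a + r) ^ k * (a + r) := by
            rw [← pow_succ, ← pow_succ']
          rw [← hy]
          simp only [mul_sub, sub_mul, mul_add (a + r), add_mul _ _ (a + r), smul_sub,
            mul_smul_comm, smul_mul_assoc, hcomm]
          abel
  obtain ⟨m, hm⟩ := exists_mem_degreeLE G htop y
  exact key (m + t).toNat y (degreeLE_mono G (by omega) hm) hy

end Graded

section Commutator

variable {R : Type*} [Ring R]

lemma commutator_mul (h a b : R) :
    h * (a * b) - a * b * h = (h * a - a * h) * b + a * (h * b - b * h) := by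
  noncomm_ring

lemma commutator_mul_right_of_eq {p q : R} (h : p * q = q * p + 1) :
    p * q * q - q * (p * q) = q := by
  rw [← mul_assoc, eq_sub_of_add_eq h.symm]
  noncomm_ring

lemma commutator_mul_left_of_eq {p q : R} (h : p * q = q * p + 1) :
    p * q * p - p * (p * q) = -p := by
  rw [mul_assoc, eq_sub_of_add_eq h.symm]
  noncomm_ring

lemma commutator_neg_swap (a b : R) : b * -a - -a * b = a * b - b * a := by
  noncomm_ring

end Commutator

section Field

variable (K : Type*) [Field K]

lemma Wp_mul_Wq : Wp K * Wq K = Wq K * Wp K + 1 := by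
  have h := RingQuot.mkAlgHom_rel K (WeylRel.comm (F := K))
  simpa [Wp, Wq] using h

/-- The commutator with `h = pq`. -/
noncomputable def adPQ : Module.End K (WeylAlgebra K) :=
  LinearMap.mulLeft K (Wp K * Wq K) - LinearMap.mulRight K (Wp K * Wq K)

/-- The graded component `A_i` as a subspace. -/
noncomputable def weylGrade (i : ℤ) : Submodule K (WeylAlgebra K) :=
  (adPQ K).eigenspace (i : K)

lemma mem_weylGrade {i : ℤ} {a : WeylAlgebra K} :
    a ∈ weylGrade K i ↔ Wp K * Wq K * a - a * (Wp K * Wq K) = (i : K) • a := by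
  rw [weylGrade, Module.End.mem_eigenspace_iff]
  rfl

lemma mem_weylGrade_of_mem_Wgrade {i : ℤ} {a : WeylAlgebra K} (h : a ∈ Wgrade K i) :
    a ∈ weylGrade K i := by
  rw [mem_weylGrade]
  exact Eq.trans h (Int.cast_smul_eq_zsmul K i a).symm

instance : SetLike.GradedMonoid (weylGrade K) where
  one_mem := by simp [mem_weylGrade]
  mul_mem i j a b ha hb := by
    rw [mem_weylGrade] at *
    rw [commutator_mul (Wp K * Wq K) a b, ha, hb, smul_mul_assoc, mul_smul_comm, ← add_smul]
    push_cast
    rfl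

lemma Wq_mem_weylGrade : Wq K ∈ weylGrade K 1 := by
  rw [mem_weylGrade, Int.cast_one, one_smul]
  exact commutator_mul_right_of_eq (Wp_mul_Wq K)

lemma Wp_mem_weylGrade : Wp K ∈ weylGrade K (-1) := by
  rw [mem_weylGrade, Int.cast_neg, Int.cast_one]
  exact (commutator_mul_left_of_eq (Wp_mul_Wq K)).trans (neg_one_smul K (Wp K)).symm

lemma Wq_mul_Wp_pow (i : ℕ) : Wq K * Wp K ^ i = Wp K ^ i * Wq K - (i : K) • Wp K ^ (i - 1) := by
  induction i with
  | zero => simp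
  | succ i ih =>
    have h : Wq K * Wp K = Wp K * Wq K - 1 := by rw [Wp_mul_Wq]; simp
    rw [pow_succ, ← mul_assoc, ih, sub_mul, mul_assoc, h]
    cases i with
    | zero => simp
    | succ i =>
      simp only [mul_sub, smul_mul_assoc, Nat.add_sub_cancel, ← pow_succ, mul_one]
      rw [← mul_assoc, ← pow_succ]
      push_cast
      module

/-- The monomials `p^i q^j` span the Weyl algebra. -/
lemma span_Wmono : Submodule.span K (Set.range fun ij : ℕ × ℕ => Wmono K ij.1 ij.2) = ⊤ := by
  set M := Submodule.span K (Set.range fun ij : ℕ × ℕ => Wmono K ij.1 ij.2)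
  have hmono (i j : ℕ) : Wmono K i j ∈ M := Submodule.subset_span ⟨(i, j), rfl⟩
  have hp : ∀ z ∈ M, Wp K * z ∈ M := by
    intro z hz
    induction hz using Submodule.span_induction with
    | mem z hz =>
      obtain ⟨⟨i, j⟩, rfl⟩ := hz
      convert hmono (i + 1) j using 1
      simp [Wmono, pow_succ', mul_assoc]
    | zero => simp
    | add y z _ _ hy hz => rw [mul_add]; exact add_mem hy hz
    | smul c z _ hz => rw [mul_smul_comm]; exact M.smul_mem c hz
  have hq : ∀ z ∈ M, Wq K * z ∈ M := by
    intro z hz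
    induction hz using Submodule.span_induction with
    | mem z hz =>
      obtain ⟨⟨i, j⟩, rfl⟩ := hz
      convert sub_mem (hmono i (j + 1)) (M.smul_mem (i : K) (hmono (i - 1) j)) using 1
      simp only [Wmono]
      rw [← mul_assoc, Wq_mul_Wp_pow, sub_mul, pow_succ', smul_mul_assoc, mul_assoc]
    | zero => simp
    | add y z _ _ hy hz => rw [mul_add]; exact add_mem hy hz
    | smul c z _ hz => rw [mul_smul_comm]; exact M.smul_mem c hz
  have hmul : ∀ (u : FreeAlgebra K (Fin 2)), ∀ z ∈ M,
      RingQuot.mkAlgHom K (WeylRel K) u * z ∈ M := by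
    intro u
    induction u using FreeAlgebra.induction with
    | grade0 r =>
      intro z hz
      rw [AlgHom.commutes, ← Algebra.smul_def]
      exact M.smul_mem r hz
    | grade1 k =>
      fin_cases k
      · exact hp
      · exact hq
    | mul u v hu hv => intro z hz; rw [map_mul, mul_assoc]; exact hu _ (hv z hz)
    | add u v hu hv => intro z hz; rw [map_add, add_mul]; exact add_mem (hu z hz) (hv z hz)
  refine eq_top_iff.2 fun y _ => ?_
  obtain ⟨u, rfl⟩ := RingQuot.mkAlgHom_surjective K (WeylRel K) y
  simpa [Wmono] using hmul u _ (hmono 0 0)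

lemma iSup_weylGrade : ⨆ i, weylGrade K i = ⊤ := by
  rw [eq_top_iff, ← span_Wmono K, Submodule.span_le]
  rintro _ ⟨⟨i, j⟩, rfl⟩
  exact Submodule.mem_iSup_of_mem _ (SetLike.mul_mem_graded
    (SetLike.pow_mem_graded i (Wp_mem_weylGrade K)) (SetLike.pow_mem_graded j (Wq_mem_weylGrade K)))

open Polynomial

/-- The action of the Weyl algebra on `K[X]`: `p` differentiates, `q` multiplies by `X`. -/
noncomputable def weylRep : WeylAlgebra K →ₐ[K] Module.End K K[X] :=
  RingQuot.liftAlgHom K ⟨FreeAlgebra.lift K ![Polynomial.derivative, LinearMap.mulLeft K X], by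
    rintro _ _ ⟨⟩
    refine LinearMap.ext fun f => ?_
    simp [add_comm]⟩

lemma weylRep_Wp (f : K[X]) : weylRep K (Wp K) f = derivative f := by
  simp [weylRep, Wp]

lemma weylRep_Wq (f : K[X]) : weylRep K (Wq K) f = X * f := by
  simp [weylRep, Wq]

lemma weylRep_Wmono (i j n : ℕ) :
    weylRep K (Wmono K i j) (X ^ n) = ((n + j).descFactorial i : K[X]) * X ^ (n + j - i) := by
  have hq : (weylRep K (Wq K) ^ j) (X ^ n) = X ^ (n + j) := by
    induction j with
    | zero => simp
    | succ j ih => rw [pow_succ', Module.End.mul_apply, ih, weylRep_Wq]; ring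
  have hp (f : K[X]) : (weylRep K (Wp K) ^ i) f = derivative^[i] f := by
    induction i with
    | zero => simp
    | succ i ih =>
      rw [pow_succ', Module.End.mul_apply, ih, weylRep_Wp, Function.iterate_succ_apply']
  rw [Wmono, map_mul, map_pow (weylRep K), map_pow (weylRep K), Module.End.mul_apply, hq, hp,
    Polynomial.iterate_derivative_X_pow_eq_natCast_mul]

/-- Diagonal matrix entries of an element of the Weyl algebra are polynomial in the index. -/
lemma exists_eval_eq_coeff_weylRep (a : WeylAlgebra K) :
    ∃ P : K[X], ∀ n : ℕ, (weylRep K a (X ^ n)).coeff n = P.eval (n : K) := by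
  have ha : a ∈ Submodule.span K (Set.range fun ij : ℕ × ℕ => Wmono K ij.1 ij.2) :=
    span_Wmono K ▸ Submodule.mem_top
  induction ha using Submodule.span_induction with
  | mem a ha =>
    obtain ⟨⟨i, j⟩, rfl⟩ := ha
    simp only [weylRep_Wmono, ← C_eq_natCast, coeff_C_mul, coeff_X_pow]
    rcases eq_or_ne i j with rfl | hij
    · refine ⟨(ascPochhammer K i).comp (X + 1), fun n => ?_⟩
      have := ascPochhammer_nat_eq_descFactorial (n + 1) i
      rw [show n + 1 + i - 1 = n + i by omega] at this
      rw [← this]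
      simp [ascPochhammer_eval_cast]
    · refine ⟨0, fun n => ?_⟩
      rcases lt_or_ge (n + j) i with h | h
      · simp [Nat.descFactorial_eq_zero_iff_lt.2 h]
      · simp [show n ≠ n + j - i by omega]
  | zero => exact ⟨0, by simp⟩
  | add a b _ _ ha hb =>
    obtain ⟨P, hP⟩ := ha
    obtain ⟨Q, hQ⟩ := hb
    exact ⟨P + Q, fun n => by simp [hP, hQ]⟩
  | smul c a _ ha =>
    obtain ⟨P, hP⟩ := ha
    exact ⟨c • P, fun n => by simp [hP]⟩

lemma coeff_weylRep_pq (f : K[X]) (k : ℕ) :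
    (weylRep K (Wp K * Wq K) f).coeff k = (k + 1) * f.coeff k := by
  rw [map_mul, Module.End.mul_apply, weylRep_Wq, weylRep_Wp, coeff_derivative, coeff_X_mul,
    mul_comm]

end Field

section CharZero

open Polynomial

lemma iSupIndep_weylGrade : iSupIndep (weylGrade F) :=
  (adPQ F).eigenspaces_iSupIndep.comp (f := fun i : ℤ => (i : F)) Int.cast_injective

/-- An element of degree `i` sends `X^n` to a multiple of `X^(n+i)`. -/
lemma coeff_weylRep_of_mem_weylGrade {i : ℤ} {a : WeylAlgebra F} (ha : a ∈ weylGrade F i)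
    (n k : ℕ) (h : (k : ℤ) ≠ n + i) : (weylRep F a (X ^ n)).coeff k = 0 := by
  have hX : weylRep F (Wp F * Wq F) (X ^ n) = ((n : F) + 1) • X ^ n := by
    ext k
    rw [coeff_weylRep_pq, coeff_smul, coeff_X_pow]
    split_ifs with hk <;> simp [hk]
  have e := congrArg (fun z => (weylRep F z (X ^ n)).coeff k) ((mem_weylGrade F).1 ha)
  simp only [map_sub, map_smul, map_mul _ a, map_mul _ _ a, LinearMap.sub_apply,
    Module.End.mul_apply, LinearMap.smul_apply, coeff_sub, coeff_smul, hX, coeff_weylRep_pq,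
    smul_eq_mul] at e
  have h' : (k : F) - (n + i) ≠ 0 := sub_ne_zero.2 (by exact_mod_cast h)
  refine (mul_eq_zero.1 (?_ : ((k : F) - (n + i)) * _ = 0)).resolve_left h'
  linear_combination e

/-- Homogeneous elements of degrees `t` and `-t` with `t > 1` never satisfy `[a, b] = 1`. -/
lemma commutator_ne_one_of_mem_weylGrade {t : ℤ} (ht : 1 < t) {a b : WeylAlgebra F}
    (ha : a ∈ weylGrade F t) (hb : b ∈ weylGrade F (-t)) : a * b - b * a ≠ 1 := by
  intro hab
  lift t to ℕ using by omega
  have hmon {f : F[X]} {m : ℕ} (hf : ∀ k, k ≠ m → f.coeff k = 0) :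
      f = f.coeff m • X ^ m := by
    ext k
    rw [coeff_smul, coeff_X_pow]
    split_ifs with hk
    · simp [hk]
    · simp [hf k hk]
  obtain ⟨P, hP⟩ := exists_eval_eq_coeff_weylRep F (b * a)
  have hone (n : ℕ) : (weylRep F (a * b) (X ^ n)).coeff n - P.eval (n : F) = 1 := by
    have := congrArg (fun z => (weylRep F z (X ^ n)).coeff n) hab
    simpa only [map_sub, LinearMap.sub_apply, coeff_sub, hP, map_one, Module.End.one_apply,
      coeff_X_pow_self] using this
  have hsmall (n : ℕ) (hn : n < t) : P.eval (n : F) = -1 := by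
    have hz : weylRep F b (X ^ n) = 0 := by
      ext k
      exact coeff_weylRep_of_mem_weylGrade F hb n k (by omega)
    have := hone n
    rw [map_mul, Module.End.mul_apply, hz, map_zero, coeff_zero] at this
    linear_combination -this
  have hstep (n : ℕ) : P.eval ((n + t : ℕ) : F) = P.eval (n : F) - 1 := by
    have hA : weylRep F a (X ^ n) = _ := hmon (m := n + t) fun k hk =>
      coeff_weylRep_of_mem_weylGrade F ha n k (by exact_mod_cast hk)
    have hB : weylRep F b (X ^ (n + t)) = _ := hmon (m := n) fun k hk =>
      coeff_weylRep_of_mem_weylGrade F hb (n + t) k (by push_cast; omega)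
    have h1 := hone (n + t)
    have h2 := hP n
    rw [map_mul, Module.End.mul_apply, hB, map_smul, coeff_smul] at h1
    rw [map_mul, Module.End.mul_apply, hA, map_smul, coeff_smul] at h2
    simp only [smul_eq_mul] at h1 h2
    linear_combination -h1 + h2
  have hlin (k : ℕ) : P.eval ((k * t : ℕ) : F) = -1 - k := by
    induction k with
    | zero => simpa using hsmall 0 (by omega)
    | succ k ih => rw [Nat.succ_mul, hstep, ih]; push_cast; ring
  have ht0 : (t : F) ≠ 0 := by exact_mod_cast (by omega : t ≠ 0)
  have hPeq : P = -1 - C (t : F)⁻¹ * X := by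
    refine Polynomial.eq_of_infinite_eval_eq _ _ ?_
    refine (Set.infinite_range_of_injective (f := fun k : ℕ => ((k * t : ℕ) : F)) ?_).mono ?_
    · intro k l hkl
      have : k * t = l * t := Nat.cast_injective (R := F) hkl
      exact Nat.eq_of_mul_eq_mul_right (by omega) this
    · rintro _ ⟨k, rfl⟩
      simp only [Set.mem_ofPred_eq, hlin]
      simp
      field_simp
  have h1 := hsmall 1 (by omega)
  rw [hPeq] at h1
  simp [ht0] at h1

end CharZero

/-- Theorem 4.2. -/
theorem unsolvable_of_top_component_self_centralizing (s t : ℤ)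
    (xc : ℤ → WeylAlgebra F) (hmem : ∀ i : ℤ, xc i ∈ Wgrade F i)
    (x : WeylAlgebra F) (hx : x = ∑ i ∈ Finset.Icc s t, xc i)
    (hyp : (xc t ≠ 0 ∧ 1 < t ∧
        Cset F (xc t) = Set.range fun f : Polynomial F => Polynomial.aeval (xc t) f) ∨
      (xc s ≠ 0 ∧ s < -1 ∧
        Cset F (xc s) = Set.range fun f : Polynomial F => Polynomial.aeval (xc s) f)) :
    ¬ Solvable F x := by
  rintro ⟨y, hy⟩
  obtain ⟨P⟩ := nonempty_gradedProj _ (iSupIndep_weylGrade F) (iSup_weylGrade F)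
  have hmem' (i : ℤ) := mem_weylGrade_of_mem_Wgrade F (hmem i)
  rcases lt_or_ge t s with hst | hst
  · rw [hx, Finset.Icc_eq_empty (by omega)] at hy
    have := congrArg (fun z => weylRep F z 1) hy
    simp at this
  rcases hyp with ⟨-, ht, hC⟩ | ⟨-, hs, hC⟩
  · rw [← Finset.add_sum_erase _ _ (Finset.right_mem_Icc.2 hst)] at hx
    rw [hx] at hy
    obtain ⟨b, hb, hab⟩ := P.exists_homogeneous_solution (iSup_weylGrade F) (by omega) (hmem' t)
      (Submodule.sum_mem _ fun i hi => le_degreeLE _ (by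
        simp only [Finset.mem_erase, Finset.mem_Icc] at hi; omega) (hmem' i))
      (fun z hz => (Set.ext_iff.1 hC z).1 hz) hy
    exact commutator_ne_one_of_mem_weylGrade F ht (hmem' t) hb hab
  · let G : ℤ → Submodule F (WeylAlgebra F) := fun i => weylGrade F (-i)
    have : SetLike.GradedMonoid G :=
      { one_mem := by simpa [G] using SetLike.GradedOne.one_mem (A := weylGrade F)
        mul_mem := fun i j a b ha hb => by
          simpa [G, neg_add_rev, add_comm] using SetLike.mul_mem_graded (A := weylGrade F) ha hb }
    let Q : GradedProj G :=
      { proj := fun i => P.proj (-i)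
        proj_same := fun i z hz => P.proj_same _ z hz
        proj_ne := fun i j z hz h => P.proj_ne _ _ z hz (by omega) }
    have htop : ⨆ i, G i = ⊤ := (Equiv.neg ℤ).iSup_comp.trans (iSup_weylGrade F)
    have hG (i : ℤ) : xc i ∈ G (-i) := by simpa [G] using hmem' i
    rw [← Finset.add_sum_erase _ _ (Finset.left_mem_Icc.2 hst)] at hx
    rw [hx] at hy
    obtain ⟨b, hb, hab⟩ := Q.exists_homogeneous_solution htop (by omega : 0 < -s) (hG s)
      (Submodule.sum_mem _ fun i hi => le_degreeLE _ (by
        simp only [Finset.mem_erase, Finset.mem_Icc] at hi; omega) (hG i))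
      (fun z hz => (Set.ext_iff.1 hC z).1 hz) hy
    refine commutator_ne_one_of_mem_weylGrade F (by omega : 1 < -s) (a := b) (b := -xc s)
      (by simpa [G] using hb) (neg_mem (by simpa using hmem' s)) ?_
    exact (commutator_neg_swap (xc s) b).trans hab
end
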